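/- arXiv:1209.1144 — 2 statements merged into one kernel-verified Lean document; each statement's English description precedes it below -/
import Mathlib

section
/- Let n ≥ 2 and 0 < λ ≤ Λ, and let p, q > 0. Suppose u, v are continuous nonnegative functions on the closed half space such that u is a viscosity supersolution of M⁻_{λ,Λ}(D²u) + v^p = 0 in ℝⁿ₊ and v is a viscosity supersolution of M⁻_{λ,Λ}(D²v) + u^q = 0 in ℝⁿ₊. If either (1) pq > 1 and (2(p+1)/(pq−1) > Λn/λ − 1 or 2(q+1)/(pq−1) > Λn/λ − 1), or (2) 2(p+1)/(pq−1) = Λn/λ − 1 and 2(q+1)/(pq−1) = Λn/λ − 1, or (3) pq = 1, then u and v are both identically zero. -/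
open scoped BigOperators

/-- The Pucci minimal operator `M⁻_{λ,Λ}`: for a symmetric matrix it equals
`λ · (sum of positive eigenvalues) + Λ · (sum of negative eigenvalues)`. -/
noncomputable def pucciMin (lam Lam : ℝ) {n : ℕ} (M : Matrix (Fin n) (Fin n) ℝ) : ℝ :=
  if h : M.IsHermitian then
    ∑ i, (lam * max (h.eigenvalues i) 0 + Lam * min (h.eigenvalues i) 0)
  else 0

/-- The Hessian matrix of `φ` at `x`. -/
noncomputable def hess {n : ℕ} (φ : EuclideanSpace ℝ (Fin n) → ℝ)
    (x : EuclideanSpace ℝ (Fin n)) : Matrix (Fin n) (Fin n) ℝ :=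
  fun i j => iteratedFDeriv ℝ 2 φ x ![EuclideanSpace.single i 1, EuclideanSpace.single j 1]

/-- `u` is a viscosity supersolution of `M⁻_{λ,Λ}(D²u) + g = 0` in `Ω`. -/
def PucciMinSupersol (lam Lam : ℝ) {n : ℕ} (Ω : Set (EuclideanSpace ℝ (Fin n)))
    (u g : EuclideanSpace ℝ (Fin n) → ℝ) : Prop :=
  ∀ x₀ ∈ Ω, ∀ φ : EuclideanSpace ℝ (Fin n) → ℝ, ContDiff ℝ 2 φ →
    IsLocalMin (fun x => u x - φ x) x₀ → pucciMin lam Lam (hess φ x₀) + g x₀ ≤ 0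


open Set Filter Topology

lemma hess_dotProduct_mulVec {n : ℕ} (φ : EuclideanSpace ℝ (Fin n) → ℝ)
    (x e : EuclideanSpace ℝ (Fin n)) :
    e.ofLp ⬝ᵥ (hess φ x).mulVec e.ofLp = fderiv ℝ (fderiv ℝ φ) x e e := by
  have he : e = ∑ i, e i • EuclideanSpace.single i (1 : ℝ) := by
    ext j
    simp [Finset.sum_apply, Pi.single_apply]
  conv_rhs => rw [he]
  simp only [map_sum, map_smul, sum_apply, smul_apply,
    smul_eq_mul, dotProduct, Matrix.mulVec, hess, iteratedFDeriv_two_apply]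
  simp only [Finset.mul_sum]
  rw [Finset.sum_comm]
  refine Finset.sum_congr rfl fun i _ => Finset.sum_congr rfl fun j _ => ?_
  simp
  ring

lemma hess_isHermitian {n : ℕ} {φ : EuclideanSpace ℝ (Fin n) → ℝ} {x : EuclideanSpace ℝ (Fin n)}
    (h : ContDiffAt ℝ 2 φ x) :
    (hess φ x).IsHermitian := by
  have hs : IsSymmSndFDerivAt ℝ φ x :=
    h.isSymmSndFDerivAt (by rw [minSmoothness_of_isRCLikeNormedField])
  ext i j
  simp only [Matrix.conjTranspose_apply, hess, iteratedFDeriv_two_apply, star_trivial]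
  exact hs.eq _ _

/-- The Hessian quadratic form is the second derivative along a line. -/
lemma hess_dotProduct_of_hasDerivAt {n : ℕ} {φ : EuclideanSpace ℝ (Fin n) → ℝ}
    {x : EuclideanSpace ℝ (Fin n)}
    (h : ContDiffAt ℝ 2 φ x) (e : EuclideanSpace ℝ (Fin n)) {g' : ℝ → ℝ} {L : ℝ}
    (h₁ : ∀ᶠ t in 𝓝 (0 : ℝ), HasDerivAt (fun t : ℝ => φ (x + t • e)) (g' t) t)
    (h₂ : HasDerivAt g' L 0) :
    e.ofLp ⬝ᵥ (hess φ x).mulVec e.ofLp = L := by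
  rw [hess_dotProduct_mulVec]
  have hline : ∀ t : ℝ, HasDerivAt (fun t : ℝ => x + t • e) e t := fun t => by
    simpa using ((hasDerivAt_id t).smul_const e).const_add x
  have hcont : Tendsto (fun t : ℝ => x + t • e) (𝓝 0) (𝓝 x) := by
    have := (hline 0).continuousAt.tendsto
    simpa using this
  have hev : ∀ᶠ t in 𝓝 (0 : ℝ), g' t = fderiv ℝ φ (x + t • e) e := by
    have h3 := hcont.eventually (h.eventually (by simp))
    filter_upwards [h₁, h3] with t ht ht3
    have hd : HasFDerivAt φ (fderiv ℝ φ (x + t • e)) (x + t • e) :=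
      (ht3.differentiableAt (by simp)).hasFDerivAt
    exact ht.unique (hd.comp_hasDerivAt t (hline t))
  have hd2 : HasFDerivAt (fderiv ℝ φ) (fderiv ℝ (fderiv ℝ φ) x) (x + (0 : ℝ) • e) := by
    have := (h.fderiv_right (m := 1) (by norm_num)).differentiableAt (by simp)
    simpa using this.hasFDerivAt
  have h4 : HasDerivAt (fun t : ℝ => fderiv ℝ φ (x + t • e) e)
      (fderiv ℝ (fderiv ℝ φ) x e e) 0 := by
    have h5 := hd2.comp_hasDerivAt (0 : ℝ) (hline 0)
    exact h5.clm_apply (hasDerivAt_const (0 : ℝ) e) |>.congr_deriv (by simp)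
  exact h4.unique (h₂.congr_of_eventuallyEq (hev.mono fun t ht => ht.symm))

/-- Lower bound for the Pucci operator from a decomposition of the quadratic form as a
difference of nonnegative forms. -/
lemma pucciMin_ge_of_quadForm {lam Lam : ℝ} (hLam : lam ≤ Lam) {n : ℕ}
    {H : Matrix (Fin n) (Fin n) ℝ} (hH : H.IsHermitian) (w w' : EuclideanSpace ℝ (Fin n))
    {κ κ' ν θ : ℝ}
    (hθ : 0 ≤ θ) (hθκ : θ ≤ κ) (hκ' : 0 ≤ κ') (hν : θ * ‖w‖ ^ 2 ≤ ν)
    (hq : ∀ e : EuclideanSpace ℝ (Fin n), e.ofLp ⬝ᵥ H.mulVec e.ofLp =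
      κ * inner ℝ e w ^ 2 - κ' * inner ℝ e w' ^ 2 - ν * ‖e‖ ^ 2) :
    lam * ((κ - θ) * ‖w‖ ^ 2) - Lam * (κ' * ‖w'‖ ^ 2 + n * ν - θ * ‖w‖ ^ 2) ≤
      pucciMin lam Lam H := by
  rw [pucciMin, dif_pos hH]
  set b := hH.eigenvectorBasis with hb
  have key : ∀ i, lam * ((κ - θ) * inner ℝ (b i) w ^ 2) -
      Lam * (κ' * inner ℝ (b i) w' ^ 2 + ν - θ * inner ℝ (b i) w ^ 2) ≤
      lam * max (hH.eigenvalues i) 0 + Lam * min (hH.eigenvalues i) 0 := by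
    intro i
    have h1 : hH.eigenvalues i =
        κ * inner ℝ (b i) w ^ 2 - κ' * inner ℝ (b i) w' ^ 2 - ν := by
      have := hq (b i)
      rw [hH.eigenvalues_eq i]
      simpa [hb] using this
    have h2 : inner ℝ (b i) w ^ 2 ≤ ‖w‖ ^ 2 := by
      have := abs_real_inner_le_norm (b i) w
      rw [b.norm_eq_one, one_mul] at this
      rw [← sq_abs]
      gcongr
    set P := (κ - θ) * inner ℝ (b i) w ^ 2 with hP
    set M := κ' * inner ℝ (b i) w' ^ 2 + ν - θ * inner ℝ (b i) w ^ 2 with hM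
    have hP0 : 0 ≤ P := mul_nonneg (by linarith) (sq_nonneg _)
    have hM0 : 0 ≤ M := by
      have h3 : θ * inner ℝ (b i) w ^ 2 ≤ ν := (mul_le_mul_of_nonneg_left h2 hθ).trans hν
      have h4 : 0 ≤ κ' * inner ℝ (b i) w' ^ 2 := mul_nonneg hκ' (sq_nonneg _)
      linarith
    have h5 : hH.eigenvalues i = P - M := by rw [h1, hP, hM]; ring
    rw [h5]
    rcases le_total 0 (P - M) with h | h
    · rw [max_eq_left h, min_eq_right h]
      nlinarith
    · rw [max_eq_right h, min_eq_left h]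
      nlinarith
  refine le_trans (le_of_eq ?_) (Finset.sum_le_sum fun i _ => key i)
  rw [Finset.sum_sub_distrib, ← Finset.mul_sum, ← Finset.mul_sum, ← Finset.mul_sum,
    Finset.sum_sub_distrib, Finset.sum_add_distrib, ← Finset.mul_sum, ← Finset.mul_sum,
    b.sum_sq_inner_right, b.sum_sq_inner_right]
  simp

/-- In the definition of viscosity supersolution the test function may be merely locally `C²`. -/
lemma PucciMinSupersol.of_contDiffAt {lam Lam : ℝ} {n : ℕ} {Ω : Set (EuclideanSpace ℝ (Fin n))}
    {u g : EuclideanSpace ℝ (Fin n) → ℝ}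
    (h : PucciMinSupersol lam Lam Ω u g) {x₀ : EuclideanSpace ℝ (Fin n)} (hx : x₀ ∈ Ω)
    {φ : EuclideanSpace ℝ (Fin n) → ℝ}
    (hφ : ContDiffAt ℝ 2 φ x₀) (hmin : IsLocalMin (fun x => u x - φ x) x₀) :
    pucciMin lam Lam (hess φ x₀) + g x₀ ≤ 0 := by
  obtain ⟨r, hr, hball⟩ := Metric.eventually_nhds_iff_ball.1 (hφ.eventually (by simp))
  let f : ContDiffBump x₀ := ⟨r / 3, r / 2, by positivity, by linarith⟩
  let ψ : EuclideanSpace ℝ (Fin n) → ℝ := fun x => f x * φ x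
  have hev : ψ =ᶠ[𝓝 x₀] φ := by
    filter_upwards [f.eventuallyEq_one] with x hx
    simp [ψ, hx]
  have hψ : ContDiff ℝ 2 ψ := by
    rw [contDiff_iff_contDiffAt]
    intro x
    by_cases hxr : x ∈ Metric.ball x₀ r
    · exact f.contDiffAt.mul (hball x hxr)
    · have : ψ =ᶠ[𝓝 x] fun _ => 0 := by
        have hopen : (Metric.closedBall x₀ (r / 2))ᶜ ∈ 𝓝 x := by
          refine Metric.isClosed_closedBall.isOpen_compl.mem_nhds ?_
          simp only [Metric.mem_ball, not_lt, mem_compl_iff, Metric.mem_closedBall, not_le] at *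
          linarith
        filter_upwards [hopen] with y hy
        simp only [mem_compl_iff, Metric.mem_closedBall, not_le] at hy
        have : f y = 0 := f.zero_of_le_dist hy.le
        simp [ψ, this]
      exact contDiffAt_const.congr_of_eventuallyEq this
  have hmin' : IsLocalMin (fun x => u x - ψ x) x₀ := by
    have h0 := hev.eq_of_nhds
    filter_upwards [hmin, hev] with x h1 h2
    simp only [h2, h0]
    exact h1
  have hh : hess ψ x₀ = hess φ x₀ := by
    ext i j
    simp only [hess]
    rw [(hev.iteratedFDeriv ℝ 2).eq_of_nhds]
  rw [← hh]
  exact h x₀ hx ψ hψ hmin'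

lemma PucciMinSupersol.translate {lam Lam : ℝ} {n : ℕ} {Ω Ω' : Set (EuclideanSpace ℝ (Fin n))}
    {u g : EuclideanSpace ℝ (Fin n) → ℝ}
    (h : PucciMinSupersol lam Lam Ω u g) (a : EuclideanSpace ℝ (Fin n)) (hΩ : ∀ x ∈ Ω', x + a ∈ Ω) :
    PucciMinSupersol lam Lam Ω' (fun x => u (x + a)) (fun x => g (x + a)) := by
  intro x₀ hx₀ φ hφ hmin
  have h1 := h (x₀ + a) (hΩ x₀ hx₀) (fun z => φ (z - a)) (hφ.comp (contDiff_id.sub contDiff_const))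
    ?_
  · have hh : hess (fun z => φ (z - a)) (x₀ + a) = hess φ x₀ := by
      ext i j
      simp only [hess]
      rw [iteratedFDeriv_comp_sub, add_sub_cancel_right]
    rwa [hh] at h1
  · have ht : Tendsto (fun z : EuclideanSpace ℝ (Fin n) => z - a) (𝓝 (x₀ + a)) (𝓝 x₀) := by
      have : ContinuousAt (fun z : EuclideanSpace ℝ (Fin n) => z - a) (x₀ + a) := by fun_prop
      simpa [ContinuousAt] using this
    filter_upwards [ht.eventually hmin] with z hz
    simpa using hz

/-- Comparison with a classical strict subsolution on a compact set. -/
lemma PucciMinSupersol.le_of_strict_subsol {lam Lam : ℝ} {n : ℕ}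
    {Ω : Set (EuclideanSpace ℝ (Fin n))}
    {u g : EuclideanSpace ℝ (Fin n) → ℝ} (h : PucciMinSupersol lam Lam Ω u g)
    {K U : Set (EuclideanSpace ℝ (Fin n))} (hK : IsCompact K)
    (hU : IsOpen U) (hUK : U ⊆ K) (hUΩ : U ⊆ Ω) {φ : EuclideanSpace ℝ (Fin n) → ℝ}
    (huK : ContinuousOn u K)
    (hφK : ContinuousOn φ K) (hbd : ∀ x ∈ K, x ∉ U → φ x ≤ u x)
    (hφ : ∀ x ∈ U, ContDiffAt ℝ 2 φ x)
    (hstrict : ∀ x ∈ U, 0 < pucciMin lam Lam (hess φ x) + g x) :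
    ∀ x ∈ K, φ x ≤ u x := by
  intro x hx
  obtain ⟨y, hyK, hy⟩ := hK.exists_isMinOn ⟨x, hx⟩ (huK.sub hφK)
  by_contra! hlt
  have hyx : u y - φ y ≤ u x - φ x := hy hx
  by_cases hyU : y ∈ U
  · have hloc : IsLocalMin (fun x => u x - φ x) y :=
      hy.isLocalMin (mem_of_superset (hU.mem_nhds hyU) hUK)
    exact absurd (h.of_contDiffAt (hUΩ hyU) (hφ y hyU) hloc) (not_le.2 (hstrict y hyU))
  · have := hbd y hyK hyU
    linarith

lemma norm_add_smul_sub_sq {n : ℕ} (x e z : EuclideanSpace ℝ (Fin n)) (t : ℝ) :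
    ‖x + t • e - z‖ ^ 2 = ‖x - z‖ ^ 2 + 2 * inner ℝ e (x - z) * t + ‖e‖ ^ 2 * t ^ 2 := by
  rw [add_sub_right_comm, norm_add_sq_real, norm_smul, inner_smul_right, mul_pow,
    real_inner_comm, Real.norm_eq_abs, sq_abs]
  ring

lemma hasDerivAt_quadratic (R S Q t : ℝ) :
    HasDerivAt (fun t : ℝ => R + 2 * S * t + Q * t ^ 2) (2 * S + 2 * Q * t) t := by
  have h1 := (hasDerivAt_id t).const_mul (2 * S)
  have h2 := (hasDerivAt_pow 2 t).const_mul Q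
  exact ((h1.const_add R).add h2).congr_deriv (by simp; ring)

lemma hess_neg_norm_sq {n : ℕ} (b : ℝ) (x z e : EuclideanSpace ℝ (Fin n)) :
    e.ofLp ⬝ᵥ (hess (fun x => -(b * ‖x - z‖ ^ 2)) x).mulVec e.ofLp = -(2 * b) * ‖e‖ ^ 2 := by
  refine hess_dotProduct_of_hasDerivAt ?_ e
    (g' := fun t => -(b * (2 * inner ℝ e (x - z) + 2 * ‖e‖ ^ 2 * t)))
    (Eventually.of_forall fun t => ?_) ?_
  · exact ((contDiff_const.mul ((contDiff_id.sub contDiff_const).norm_sq ℝ)).neg).contDiffAt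
  · simp only [norm_add_smul_sub_sq]
    exact ((hasDerivAt_quadratic _ _ _ t).const_mul b).neg
  · have h1 := ((((hasDerivAt_id (0 : ℝ)).const_mul (2 * ‖e‖ ^ 2)).const_add
      (2 * inner ℝ e (x - z))).const_mul b).neg
    exact h1.congr_deriv (by ring)

lemma pucciMin_hess_neg_norm_sq {lam Lam : ℝ} (hLam : lam ≤ Lam) {n : ℕ}
    {b : ℝ} (hb : 0 ≤ b) (x z : EuclideanSpace ℝ (Fin n)) :
    -(2 * Lam * n * b) ≤ pucciMin lam Lam (hess (fun x => -(b * ‖x - z‖ ^ 2)) x) := by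
  have hH : (hess (fun x : EuclideanSpace ℝ (Fin n) => -(b * ‖x - z‖ ^ 2)) x).IsHermitian :=
    hess_isHermitian
      ((contDiff_const.mul ((contDiff_id.sub contDiff_const).norm_sq ℝ)).neg).contDiffAt
  have := pucciMin_ge_of_quadForm hLam hH 0 0 (κ := 0) (κ' := 0) (ν := 2 * b) (θ := 0)
    le_rfl le_rfl le_rfl (by simpa using hb) (fun e => by rw [hess_neg_norm_sq]; simp)
  refine le_trans (le_of_eq ?_) this
  simp
  ring

lemma contDiffAt_norm_sub_sq_rpow {n : ℕ} {x z : EuclideanSpace ℝ (Fin n)} (hx : x ≠ z) (σ : ℝ) :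
    ContDiffAt ℝ 2 (fun x : EuclideanSpace ℝ (Fin n) => (‖x - z‖ ^ 2) ^ σ) x := by
  refine ContDiffAt.rpow_const_of_ne ?_ ?_
  · exact ((contDiff_id.sub contDiff_const).norm_sq ℝ).contDiffAt
  · have : 0 < ‖x - z‖ := norm_pos_iff.2 (sub_ne_zero.2 hx)
    positivity

lemma hess_radial {n : ℕ} {x z : EuclideanSpace ℝ (Fin n)} (hx : x ≠ z) (c d σ : ℝ)
    (e : EuclideanSpace ℝ (Fin n)) :
    e.ofLp ⬝ᵥ (hess (fun x => c * ((‖x - z‖ ^ 2) ^ σ - d)) x).mulVec e.ofLp =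
      c * (‖x - z‖ ^ 2) ^ σ * (4 * σ * (σ - 1) * inner ℝ e (x - z) ^ 2 / (‖x - z‖ ^ 2) ^ 2
        + 2 * σ * ‖e‖ ^ 2 / ‖x - z‖ ^ 2) := by
  have hR : 0 < ‖x - z‖ ^ 2 := by
    have : 0 < ‖x - z‖ := norm_pos_iff.2 (sub_ne_zero.2 hx)
    positivity
  have hR' := hR.ne'
  set R := ‖x - z‖ ^ 2 with hRdef
  set S := inner ℝ e (x - z) with hS
  set Q := ‖e‖ ^ 2 with hQ
  have hpos : ∀ᶠ t in 𝓝 (0 : ℝ), R + 2 * S * t + Q * t ^ 2 ≠ 0 := by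
    have hc : ContinuousAt (fun t : ℝ => R + 2 * S * t + Q * t ^ 2) 0 := by fun_prop
    exact hc.eventually_ne (by simpa using hR')
  refine hess_dotProduct_of_hasDerivAt ?_ e
    (g' := fun t => c * ((2 * S + 2 * Q * t) * σ * (R + 2 * S * t + Q * t ^ 2) ^ (σ - 1)))
    ?_ ?_
  · exact contDiffAt_const.mul ((contDiffAt_norm_sub_sq_rpow hx σ).sub contDiffAt_const)
  · filter_upwards [hpos] with t ht
    simp only [norm_add_smul_sub_sq]
    exact (((hasDerivAt_quadratic R S Q t).rpow_const (Or.inl ht)).sub_const d).const_mul c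
  · have h0 : R + 2 * S * 0 + Q * 0 ^ 2 = R := by ring
    have h1 := (hasDerivAt_quadratic R S Q 0).rpow_const (p := σ - 1) (Or.inl (by rwa [h0]))
    have h2 : HasDerivAt (fun t : ℝ => (2 * S + 2 * Q * t) * σ) (2 * Q * σ) 0 :=
      ((((hasDerivAt_id (0 : ℝ)).const_mul (2 * Q)).const_add (2 * S)).mul_const σ).congr_deriv
        (by ring)
    refine ((h2.mul h1).const_mul c).congr_deriv ?_
    simp only [h0, Real.rpow_sub_one hR']
    field_simp
    ring

/-- The radial power `|x - z|^{-k}` with `k = Λ n / λ` is a strict subsolution away from `z`. -/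
lemma pucciMin_hess_radial_pos {lam Lam : ℝ} (hlam : 0 < lam) (hLam : lam ≤ Lam) {n : ℕ}
    (hn : 0 < n) {x z : EuclideanSpace ℝ (Fin n)} (hx : x ≠ z) {c : ℝ} (hc : 0 < c) (d : ℝ) :
    0 < pucciMin lam Lam
      (hess (fun x => c * ((‖x - z‖ ^ 2) ^ (-(Lam * n / lam / 2)) - d)) x) := by
  have hR : 0 < ‖x - z‖ ^ 2 := by
    have : 0 < ‖x - z‖ := norm_pos_iff.2 (sub_ne_zero.2 hx)
    positivity
  have hR' : ‖x - z‖ ≠ 0 := norm_ne_zero_iff.2 (sub_ne_zero.2 hx)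
  have hL : 0 < Lam := hlam.trans_le hLam
  obtain ⟨k, hk⟩ : ∃ k, k = Lam * n / lam := ⟨_, rfl⟩
  have hk0 : 0 < k := by rw [hk]; positivity
  have hlk : lam * k = Lam * n := by rw [hk]; field_simp
  rw [← hk]
  obtain ⟨P, hP⟩ : ∃ P, P = (‖x - z‖ ^ 2) ^ (-(k / 2)) := ⟨_, rfl⟩
  have hP0 : 0 < P := by rw [hP]; exact Real.rpow_pos_of_pos hR _
  have hH := hess_isHermitian (contDiffAt_const (c := c).mul
    ((contDiffAt_norm_sub_sq_rpow hx (-(k / 2))).sub (contDiffAt_const (c := d))))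
  have := pucciMin_ge_of_quadForm hLam hH (x - z) 0 (κ := c * P * k * (k + 2) / (‖x - z‖ ^ 2) ^ 2)
    (κ' := 0) (ν := c * P * k / ‖x - z‖ ^ 2) (θ := c * P * k / (‖x - z‖ ^ 2) ^ 2)
    (by positivity) (div_le_div_of_nonneg_right (by nlinarith [mul_pos (mul_pos hc hP0) hk0])
      (by positivity)) le_rfl
    (le_of_eq (by field_simp))
    (fun e => by
      rw [hess_radial hx, ← hP]
      field_simp
      ring)
  refine lt_of_lt_of_le ?_ this
  have h2 : lam * ((c * P * k * (k + 2) / (‖x - z‖ ^ 2) ^ 2 -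
        c * P * k / (‖x - z‖ ^ 2) ^ 2) * ‖x - z‖ ^ 2) -
      Lam * (0 * ‖(0 : EuclideanSpace ℝ (Fin n))‖ ^ 2 + n * (c * P * k / ‖x - z‖ ^ 2) -
        c * P * k / (‖x - z‖ ^ 2) ^ 2 * ‖x - z‖ ^ 2) =
      c * P * k / ‖x - z‖ ^ 2 * (lam * k - Lam * n + lam + Lam) := by
    field_simp
    ring
  rw [h2, hlk]
  have : 0 < Lam * n - Lam * n + lam + Lam := by linarith
  positivity

lemma hasDerivAt_affine (A B t : ℝ) : HasDerivAt (fun t : ℝ => A + B * t) B t := by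
  simpa using ((hasDerivAt_id t).const_mul B).const_add A

lemma contDiffAt_halfspace_barrier {n : ℕ} {N : Fin n} {x : EuclideanSpace ℝ (Fin n)}
    (hx : 0 < x N) (c d β σ : ℝ) :
    ContDiffAt ℝ 2
      (fun x : EuclideanSpace ℝ (Fin n) => c * ((x N) ^ β * (‖x‖ ^ 2) ^ σ - d)) x := by
  have hx0 : x ≠ 0 := by rintro rfl; simp at hx
  have h1 : ContDiffAt ℝ 2 (fun x : EuclideanSpace ℝ (Fin n) => (x N) ^ β) x := by
    refine ContDiffAt.rpow_const_of_ne ?_ hx.ne'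
    exact (EuclideanSpace.proj N : EuclideanSpace ℝ (Fin n) →L[ℝ] ℝ).contDiff.contDiffAt
  have h2 := contDiffAt_norm_sub_sq_rpow hx0 σ
  simp only [sub_zero] at h2
  exact contDiffAt_const.mul ((h1.mul h2).sub contDiffAt_const)

lemma hess_halfspace_barrier {n : ℕ} {N : Fin n} {x : EuclideanSpace ℝ (Fin n)}
    (hx : 0 < x N) (c d β σ : ℝ) (e : EuclideanSpace ℝ (Fin n)) :
    e.ofLp ⬝ᵥ (hess (fun x => c * ((x N) ^ β * (‖x‖ ^ 2) ^ σ - d)) x).mulVec e.ofLp =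
      c * ((x N) ^ β * (‖x‖ ^ 2) ^ σ) *
        (β * (β - 1) * (e N) ^ 2 / (x N) ^ 2
          + 4 * β * σ * e N * inner ℝ e x / (x N * ‖x‖ ^ 2)
          + 4 * σ * (σ - 1) * inner ℝ e x ^ 2 / (‖x‖ ^ 2) ^ 2
          + 2 * σ * ‖e‖ ^ 2 / ‖x‖ ^ 2) := by
  have hx0 : x ≠ 0 := by rintro rfl; simp at hx
  have hR : 0 < ‖x‖ ^ 2 := by
    have : 0 < ‖x‖ := norm_pos_iff.2 hx0
    positivity
  have hR' := hR.ne'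
  have hn : ∀ t : ℝ, ‖x + t • e‖ ^ 2 = ‖x‖ ^ 2 + 2 * inner ℝ e x * t + ‖e‖ ^ 2 * t ^ 2 := by
    intro t
    simpa using norm_add_smul_sub_sq x e 0 t
  have hN : ∀ t : ℝ, (x + t • e) N = x N + e N * t := by
    intro t
    simp [mul_comm]
  have hcd := contDiffAt_halfspace_barrier hx c d β σ
  refine hess_dotProduct_of_hasDerivAt hcd e
    (g' := fun t => c * ((e N * β * (x N + e N * t) ^ (β - 1)) *
        (‖x‖ ^ 2 + 2 * inner ℝ e x * t + ‖e‖ ^ 2 * t ^ 2) ^ σ + (x N + e N * t) ^ β *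
      ((2 * inner ℝ e x + 2 * ‖e‖ ^ 2 * t) * σ *
        (‖x‖ ^ 2 + 2 * inner ℝ e x * t + ‖e‖ ^ 2 * t ^ 2) ^ (σ - 1))))
    ?_ ?_
  · have hpos : ∀ᶠ t in 𝓝 (0 : ℝ), ‖x‖ ^ 2 + 2 * inner ℝ e x * t + ‖e‖ ^ 2 * t ^ 2 ≠ 0 := by
      have hc : ContinuousAt
        (fun t : ℝ => ‖x‖ ^ 2 + 2 * inner ℝ e x * t + ‖e‖ ^ 2 * t ^ 2) 0 := by fun_prop
      exact hc.eventually_ne (by simpa using hx0)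
    have hpos' : ∀ᶠ t in 𝓝 (0 : ℝ), x N + e N * t ≠ 0 := by
      have hc : ContinuousAt (fun t : ℝ => x N + e N * t) 0 := by fun_prop
      exact hc.eventually_ne (by simpa using hx.ne')
    filter_upwards [hpos, hpos'] with t ht ht'
    simp only [hn, hN]
    exact ((((hasDerivAt_affine (x N) (e N) t).rpow_const (Or.inl ht')).mul
      ((hasDerivAt_quadratic _ _ _ t).rpow_const (Or.inl ht))).sub_const d).const_mul c
  · generalize x N = A at *
    generalize ‖x‖ ^ 2 = R at *
    generalize inner ℝ e x = S at *
    generalize ‖e‖ ^ 2 = Q at *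
    generalize e N = B at *
    have h0 : R + 2 * S * 0 + Q * 0 ^ 2 = R := by ring
    have h0' : A + B * 0 = A := by ring
    have h1 := fun p => (hasDerivAt_quadratic R S Q 0).rpow_const (p := p)
      (Or.inl (by rwa [h0]))
    have h1' := fun p => (hasDerivAt_affine A B 0).rpow_const (p := p)
      (Or.inl (by rw [h0']; exact hx.ne'))
    have h2 : HasDerivAt (fun t : ℝ => (2 * S + 2 * Q * t) * σ) (2 * Q * σ) 0 :=
      ((((hasDerivAt_id (0 : ℝ)).const_mul (2 * Q)).const_add (2 * S)).mul_const σ).congr_deriv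
        (by ring)
    refine (((((h1' (β - 1)).const_mul (B * β)).mul (h1 σ)).add
      ((h1' β).mul (h2.mul (h1 (σ - 1))))).const_mul c).congr_deriv ?_
    simp only [h0, h0', Real.rpow_sub_one hR', Real.rpow_sub_one hx.ne', Pi.mul_apply]
    field_simp
    ring

/-- The functions `xₙ^{ω+ε} |x|^{-γ}` with `ω = Λ / λ` and `γ = ω n + ω - 1` are subsolutions up to
an explicit error of order `ε`, which only matters away from the boundary `xₙ = 0`. -/
lemma pucciMin_hess_halfspace_barrier {lam Lam ω γ β ε c : ℝ} (hlam : 0 < lam)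
    (hLam : lam ≤ Lam) {n : ℕ} (hn : 2 ≤ n) (hω : lam * ω = Lam) (hγ : γ = ω * n + ω - 1)
    (hβ : β = ω + ε) (hε : 0 ≤ ε) (hε' : ε ≤ 1 / 2) (hc : 0 < c) (d : ℝ) {N : Fin n}
    {x : EuclideanSpace ℝ (Fin n)} (hx : 0 < x N) :
    lam * (c * ((x N) ^ β * (‖x‖ ^ 2) ^ (-(γ / 2)))) * ε * γ *
        (-(2 / ‖x‖ ^ 2) + β / ((γ + 2) * (x N) ^ 2)) ≤
      pucciMin lam Lam (hess (fun x => c * ((x N) ^ β * (‖x‖ ^ 2) ^ (-(γ / 2)) - d)) x) := by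
  have hn' : (2 : ℝ) ≤ n := by exact_mod_cast hn
  have hω1 : 1 ≤ ω := by
    by_contra! h
    nlinarith
  have hωn : 2 * ω ≤ ω * n := by nlinarith
  have hx0 : ‖x‖ ≠ 0 := by
    rw [norm_ne_zero_iff]
    rintro rfl
    simp at hx
  have hR : 0 < ‖x‖ ^ 2 := by positivity
  have hAR : (x N) ^ 2 ≤ ‖x‖ ^ 2 := by
    have := PiLp.norm_apply_le x N
    rw [← sq_abs (x N)]
    gcongr
    simpa using this
  have hH := hess_isHermitian (contDiffAt_halfspace_barrier hx c d β (-(γ / 2)))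
  have hq := hess_halfspace_barrier hx c d β (-(γ / 2))
  obtain ⟨P, hP⟩ : ∃ P, P = (x N) ^ β * (‖x‖ ^ 2) ^ (-(γ / 2)) := ⟨_, rfl⟩
  have hP0 : 0 < P := by
    rw [hP]
    exact mul_pos (Real.rpow_pos_of_pos hx _) (Real.rpow_pos_of_pos hR _)
  rw [← hP] at hq ⊢
  have hγ0 : 2 ≤ γ := by linarith
  have hγβ : 0 ≤ γ + 2 - 2 * β := by linarith
  set w : EuclideanSpace ℝ (Fin n) :=
    (1 / ‖x‖ ^ 2) • x - (β / ((γ + 2) * x N)) • EuclideanSpace.single N 1 with hw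
  have hwe : ∀ e : EuclideanSpace ℝ (Fin n),
      inner ℝ e w = inner ℝ e x / ‖x‖ ^ 2 - β / ((γ + 2) * x N) * e N := by
    intro e
    rw [hw, inner_sub_right, inner_smul_right, inner_smul_right,
      EuclideanSpace.inner_single_right]
    simp
    ring
  have hW : ‖w‖ ^ 2 = (1 - 2 * β / (γ + 2)) / ‖x‖ ^ 2 + β ^ 2 / ((γ + 2) ^ 2 * (x N) ^ 2) := by
    rw [← real_inner_self_eq_norm_sq, hwe w, real_inner_comm, hwe x, real_inner_self_eq_norm_sq]
    have : w N = (1 / ‖x‖ ^ 2) * x N - β / ((γ + 2) * x N) := by simp [hw]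
    rw [this]
    field_simp
    ring
  have hinv : 1 / ‖x‖ ^ 2 ≤ 1 / (x N) ^ 2 := by gcongr
  have hγβ2 : γ + 2 ≤ (γ + 2 - β) ^ 2 := by
    have h1 : ω * n + 1 / 2 ≤ γ + 2 - β := by linarith
    nlinarith
  have hWge : 1 / ((γ + 2) * ‖x‖ ^ 2) ≤ ‖w‖ ^ 2 := by
    rw [hW]
    have h1 : β ^ 2 / ((γ + 2) ^ 2 * ‖x‖ ^ 2) ≤ β ^ 2 / ((γ + 2) ^ 2 * (x N) ^ 2) := by
      gcongr
    have h2 : 1 / ((γ + 2) * ‖x‖ ^ 2) ≤ (γ + 2 - β) ^ 2 / ((γ + 2) ^ 2 * ‖x‖ ^ 2) := by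
      rw [div_le_div_iff₀ (by positivity) (by positivity)]
      have : 0 < (γ + 2) * ‖x‖ ^ 2 := by positivity
      nlinarith
    have h3 : (γ + 2 - β) ^ 2 / ((γ + 2) ^ 2 * ‖x‖ ^ 2) =
        (1 - 2 * β / (γ + 2)) / ‖x‖ ^ 2 + β ^ 2 / ((γ + 2) ^ 2 * ‖x‖ ^ 2) := by
      field_simp
      ring
    linarith
  have hW0 : 0 < ‖w‖ ^ 2 := lt_of_lt_of_le (by positivity) hWge
  have hβ0 : 0 ≤ β := by linarith
  have key := pucciMin_ge_of_quadForm hLam hH w (EuclideanSpace.single N 1)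
    (κ := c * P * γ * (γ + 2)) (κ' := c * P * (β * (γ + 2 - 2 * β) / ((γ + 2) * (x N) ^ 2)))
    (ν := c * P * γ / ‖x‖ ^ 2) (θ := c * P * γ / ‖x‖ ^ 2 / ‖w‖ ^ 2)
    (by positivity)
    (by
      rw [div_le_iff₀ hW0]
      have h1 : c * P * γ * (γ + 2) * (1 / ((γ + 2) * ‖x‖ ^ 2)) ≤
          c * P * γ * (γ + 2) * ‖w‖ ^ 2 := by
        gcongr
      refine le_trans (le_of_eq ?_) h1
      field_simp)
    (by positivity) (le_of_eq (div_mul_cancel₀ _ hW0.ne'))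
    (fun e => by
      rw [hq, hwe, EuclideanSpace.inner_single_right]
      simp
      field_simp
      ring)
  refine le_trans ?_ key
  have h4 : (c * P * γ * (γ + 2) - c * P * γ / ‖x‖ ^ 2 / ‖w‖ ^ 2) * ‖w‖ ^ 2 =
      c * P * γ * (γ + 2) * ‖w‖ ^ 2 - c * P * γ / ‖x‖ ^ 2 := by
    rw [sub_mul, div_mul_cancel₀ _ hW0.ne']
  rw [h4, div_mul_cancel₀ _ hW0.ne', hW]
  have h5 : 0 ≤ lam * (c * P) * (2 * ω * β * (β - 1) / ((γ + 2) * (x N) ^ 2)) := by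
    have : 0 ≤ β - 1 := by linarith
    have : 0 ≤ ω := by linarith
    positivity
  refine le_trans (le_add_of_nonneg_right h5) (le_of_eq ?_)
  simp
  rw [← hω]
  have hωn' : ω * n = γ + 1 - ω := by linarith
  have hε : ε = β - ω := by linarith
  have h6 : lam * ω * (n * (c * P * γ / ‖x‖ ^ 2)) =
      lam * (γ + 1 - ω) * (c * P * γ / ‖x‖ ^ 2) := by rw [← hωn']; ring
  rw [mul_sub (lam * ω), mul_add (lam * ω), h6, hε]
  field_simp
  ring

lemma abs_apply_sub_le_norm {n : ℕ} (x y : EuclideanSpace ℝ (Fin n)) (N : Fin n) :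
    |x N - y N| ≤ ‖x - y‖ := by
  simpa using PiLp.norm_apply_le (x - y) N

lemma closedBall_subset_halfspace {n : ℕ} {z : EuclideanSpace ℝ (Fin n)} {N : Fin n} {R : ℝ}
    (h : R ≤ z N) : Metric.closedBall z R ⊆ {x | 0 ≤ x N} := by
  intro x hx
  have h1 := abs_le.1 (abs_apply_sub_le_norm x z N)
  rw [mem_closedBall_iff_norm] at hx
  simp only [mem_ofPred_eq]
  linarith

lemma ball_subset_halfspace {n : ℕ} {z : EuclideanSpace ℝ (Fin n)} {N : Fin n} {R : ℝ}
    (h : R ≤ z N) : Metric.ball z R ⊆ {x | 0 < x N} := by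
  intro x hx
  have h1 := abs_le.1 (abs_apply_sub_le_norm x z N)
  rw [mem_ball_iff_norm] at hx
  simp only [mem_ofPred_eq]
  linarith

/-- Propagation of positivity from a small ball to a larger concentric one. -/
lemma PucciMinSupersol.radial_lower_bound {lam Lam : ℝ} (hlam : 0 < lam) (hLam : lam ≤ Lam)
    {n : ℕ} (hn : 0 < n) {Ω : Set (EuclideanSpace ℝ (Fin n))} {u g : EuclideanSpace ℝ (Fin n) → ℝ}
    (h : PucciMinSupersol lam Lam Ω u g) {z : EuclideanSpace ℝ (Fin n)} {s R m : ℝ} (hs : 0 < s)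
    (hsR : s < R) (hm : 0 ≤ m) (hΩ : Metric.ball z R ⊆ Ω)
    (hu : ContinuousOn u (Metric.closedBall z R)) (hu0 : ∀ x ∈ Metric.closedBall z R, 0 ≤ u x)
    (hg : ∀ x ∈ Metric.ball z R, 0 ≤ g x) (hum : ∀ x ∈ Metric.closedBall z s, m ≤ u x)
    {x : EuclideanSpace ℝ (Fin n)} (hsx : s ≤ ‖x - z‖) (hxR : ‖x - z‖ ≤ R) :
    m / ((s ^ 2) ^ (-(Lam * n / lam / 2)) - (R ^ 2) ^ (-(Lam * n / lam / 2))) *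
      ((‖x - z‖ ^ 2) ^ (-(Lam * n / lam / 2)) - (R ^ 2) ^ (-(Lam * n / lam / 2))) ≤ u x := by
  rcases hm.eq_or_lt with rfl | hm
  · simpa using hu0 x (mem_closedBall_iff_norm.2 hxR)
  have hL : 0 < Lam := hlam.trans_le hLam
  have hσ : -(Lam * n / lam / 2) < 0 := by
    have : (0 : ℝ) < n := by exact_mod_cast hn
    have : 0 < Lam * n / lam / 2 := by positivity
    linarith
  set d := (R ^ 2) ^ (-(Lam * n / lam / 2)) with hd
  have hden : 0 < (s ^ 2) ^ (-(Lam * n / lam / 2)) - d :=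
    sub_pos.2 (Real.rpow_lt_rpow_of_neg (by positivity) (by gcongr) hσ)
  have hne : ∀ x : EuclideanSpace ℝ (Fin n), s ≤ ‖x - z‖ → x ≠ z := by
    rintro x hx rfl
    rw [sub_self, norm_zero] at hx
    linarith
  refine h.le_of_strict_subsol
    (K := Metric.closedBall z R ∩ {x | s ≤ ‖x - z‖}) (U := {x | s < ‖x - z‖} ∩ Metric.ball z R)
    (φ := fun x => m / ((s ^ 2) ^ (-(Lam * n / lam / 2)) - d) *
      ((‖x - z‖ ^ 2) ^ (-(Lam * n / lam / 2)) - d))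
    ((isCompact_closedBall z R).inter_right
      (isClosed_le continuous_const (continuous_id.sub continuous_const).norm))
    ((isOpen_lt continuous_const (continuous_id.sub continuous_const).norm).inter
      Metric.isOpen_ball)
    (fun x hx => ⟨Metric.ball_subset_closedBall hx.2, show s ≤ ‖x - z‖ from le_of_lt hx.1⟩)
    (fun x hx => hΩ hx.2) (hu.mono inter_subset_left) ?_ ?_ ?_ ?_ x
    ⟨mem_closedBall_iff_norm.2 hxR, hsx⟩
  · intro x hx
    exact (contDiffAt_const.mul ((contDiffAt_norm_sub_sq_rpow (hne x hx.2) _).sub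
      contDiffAt_const)).continuousAt.continuousWithinAt
  · intro x hx hxU
    have hx2 : s ≤ ‖x - z‖ := hx.2
    have hx1 := mem_closedBall_iff_norm.1 hx.1
    by_cases hxs : s < ‖x - z‖
    · have hxR' : ‖x - z‖ = R := by
        refine le_antisymm hx1 ?_
        by_contra! hlt
        exact hxU ⟨hxs, mem_ball_iff_norm.2 hlt⟩
      simp only [hxR', ← hd, sub_self, mul_zero]
      exact hu0 x hx.1
    · have hxs' : ‖x - z‖ = s := le_antisymm (not_lt.1 hxs) hx2
      simp only [hxs']
      rw [div_mul_cancel₀ _ hden.ne']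
      exact hum x (mem_closedBall_iff_norm.2 hxs'.le)
  · intro x hx
    exact contDiffAt_const.mul ((contDiffAt_norm_sub_sq_rpow (hne x (le_of_lt hx.1)) _).sub
      contDiffAt_const)
  · intro x hx
    have h1 := pucciMin_hess_radial_pos hlam hLam hn (hne x (le_of_lt hx.1)) (div_pos hm hden) d
    have h2 := hg x hx.2
    linarith

/-- Strong minimum principle in the half space. -/
lemma PucciMinSupersol.pos_of_pos {lam Lam : ℝ} (hlam : 0 < lam) (hLam : lam ≤ Lam)
    {n : ℕ} {N : Fin n} {u g : EuclideanSpace ℝ (Fin n) → ℝ}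
    (h : PucciMinSupersol lam Lam {x | 0 < x N} u g) (hu : ContinuousOn u {x | 0 ≤ x N})
    (hu0 : ∀ x, 0 ≤ x N → 0 ≤ u x) (hg : ∀ x, 0 ≤ x N → 0 ≤ g x)
    {x₁ : EuclideanSpace ℝ (Fin n)} (hx₁ : 0 < x₁ N) (hux₁ : 0 < u x₁) :
    ∀ x : EuclideanSpace ℝ (Fin n), 0 < x N → 0 < u x := by
  have hn : 0 < n := N.pos
  have hΩ : IsOpen {x : EuclideanSpace ℝ (Fin n) | 0 < x N} :=
    isOpen_lt continuous_const (EuclideanSpace.proj N : EuclideanSpace ℝ (Fin n) →L[ℝ] ℝ).continuous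
  have huΩ : ContinuousOn u {x | 0 < x N} := hu.mono fun x hx => show 0 ≤ x N from le_of_lt hx
  have hconv : Convex ℝ {x : EuclideanSpace ℝ (Fin n) | 0 < x N} :=
    convex_halfSpace_gt
      (EuclideanSpace.proj N : EuclideanSpace ℝ (Fin n) →L[ℝ] ℝ).toLinearMap.isLinear 0
  have hU : IsOpen ({x : EuclideanSpace ℝ (Fin n) | 0 < x N} ∩ u ⁻¹' Ioi 0) :=
    huΩ.isOpen_inter_preimage hΩ isOpen_Ioi
  have hspread : ∀ x y : EuclideanSpace ℝ (Fin n), 0 < x N → 0 < u x → ‖y - x‖ < x N → 0 < u y := by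
    intro x y hx hux hyx
    obtain ⟨s₀, hs₀, hball⟩ := Metric.eventually_nhds_iff_ball.1
      ((huΩ.continuousAt (hΩ.mem_nhds hx)).eventually (lt_mem_nhds (half_lt_self hux)))
    set s := min (s₀ / 2) (x N / 2) with hs
    have hs0 : 0 < s := by positivity
    have hsN : s < x N := (min_le_right _ _).trans_lt (half_lt_self hx)
    have hlow : ∀ w ∈ Metric.closedBall x s, u x / 2 ≤ u w := fun w hw =>
      (hball w (Metric.closedBall_subset_ball
        ((min_le_left _ _).trans_lt (half_lt_self hs₀)) hw)).le
    rcases le_total ‖y - x‖ s with hys | hys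
    · exact (half_pos hux).trans_le (hlow y (mem_closedBall_iff_norm.2 hys))
    · refine lt_of_lt_of_le ?_ (h.radial_lower_bound hlam hLam hn hs0 hsN (half_pos hux).le
        (ball_subset_halfspace le_rfl) (hu.mono (closedBall_subset_halfspace le_rfl))
        (fun w hw => hu0 w (closedBall_subset_halfspace le_rfl hw))
        (fun w hw => hg w (le_of_lt (ball_subset_halfspace le_rfl hw))) hlow hys hyx.le)
      have hL : 0 < Lam := hlam.trans_le hLam
      have hσ : -(Lam * n / lam / 2) < 0 := by
        have : (0 : ℝ) < n := by exact_mod_cast hn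
        have : 0 < Lam * n / lam / 2 := by positivity
        linarith
      have h0 : 0 < ‖y - x‖ := hs0.trans_le hys
      refine mul_pos (div_pos (half_pos hux) (sub_pos.2 ?_)) (sub_pos.2 ?_)
      · exact Real.rpow_lt_rpow_of_neg (by positivity) (by gcongr) hσ
      · exact Real.rpow_lt_rpow_of_neg (by positivity) (by gcongr) hσ
  have hsub := hconv.isPreconnected.subset_of_closure_inter_subset hU ⟨x₁, hx₁, hx₁, hux₁⟩ (by
    rintro y ⟨hy, hyN⟩
    refine ⟨hyN, ?_⟩
    have hyN' : 0 < y N := hyN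
    obtain ⟨x, hx, hxy⟩ := Metric.mem_closure_iff.1 hy (y N / 2) (by positivity)
    rw [dist_eq_norm] at hxy
    have h1 := abs_le.1 (abs_apply_sub_le_norm y x N)
    exact hspread x y hx.1 hx.2 (by linarith))
  exact fun x hx => (hsub hx).2

/-- Touching by a concave paraboloid: a supersolution that is small somewhere in a ball has a
small right-hand side somewhere in a larger ball. -/
lemma PucciMinSupersol.exists_rhs_le {lam Lam : ℝ} (hLam : lam ≤ Lam)
    {n : ℕ} {Ω : Set (EuclideanSpace ℝ (Fin n))} {u g : EuclideanSpace ℝ (Fin n) → ℝ}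
    (h : PucciMinSupersol lam Lam Ω u g) {z : EuclideanSpace ℝ (Fin n)} {R : ℝ} (hR : 0 < R)
    (hΩ : Metric.ball z R ⊆ Ω) (hu : ContinuousOn u (Metric.closedBall z R))
    (hu0 : ∀ x ∈ Metric.closedBall z R, 0 ≤ u x) {y : EuclideanSpace ℝ (Fin n)}
    (hy : y ∈ Metric.closedBall z (R / 2)) (huy : 0 < u y) :
    ∃ x ∈ Metric.ball z (3 / 4 * R), g x ≤ 8 * Lam * n * u y / R ^ 2 := by
  set b := 4 * u y / R ^ 2 with hb
  have hb0 : 0 < b := by positivity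
  have hbR : b * R ^ 2 = 4 * u y := by rw [hb]; field_simp
  have hsub : Metric.closedBall z (3 / 4 * R) ⊆ Metric.closedBall z R :=
    Metric.closedBall_subset_closedBall (by linarith)
  have hyK : y ∈ Metric.closedBall z (3 / 4 * R) :=
    Metric.closedBall_subset_closedBall (by linarith) hy
  have hcont : ContinuousOn (fun x => u x - -(b * ‖x - z‖ ^ 2))
      (Metric.closedBall z (3 / 4 * R)) :=
    (hu.mono hsub).sub (by fun_prop)
  obtain ⟨x, hx, hmin⟩ := (isCompact_closedBall z (3 / 4 * R)).exists_isMinOn ⟨y, hyK⟩ hcont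
  have hxy : u x - -(b * ‖x - z‖ ^ 2) ≤ u y - -(b * ‖y - z‖ ^ 2) := hmin hyK
  have hy2 : ‖y - z‖ ^ 2 ≤ (R / 2) ^ 2 := by
    have := mem_closedBall_iff_norm.1 hy
    gcongr
  have hxb : x ∈ Metric.ball z (3 / 4 * R) := by
    rw [mem_ball_iff_norm]
    by_contra! hge
    have h1 : (3 / 4 * R) ^ 2 ≤ ‖x - z‖ ^ 2 := by gcongr
    have h2 := hu0 x (hsub hx)
    nlinarith
  refine ⟨x, hxb, ?_⟩
  have h3 := h.of_contDiffAt (hΩ (Metric.ball_subset_ball (by linarith) hxb))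
    ((contDiff_const.mul ((contDiff_id.sub contDiff_const).norm_sq ℝ)).neg).contDiffAt
    (hmin.isLocalMin (mem_of_superset (Metric.isOpen_ball.mem_nhds hxb)
      Metric.ball_subset_closedBall))
  have h4 := pucciMin_hess_neg_norm_sq hLam hb0.le x z
  have h5 : 8 * Lam * n * u y / R ^ 2 = 2 * Lam * n * b := by rw [hb]; ring
  rw [h5]
  simp only [id_eq] at h3
  linarith

/-- Scale-invariant interior estimate coupling the minima of the two components. -/
lemma exists_interior_estimate {lam Lam : ℝ} (hlam : 0 < lam) (hLam : lam ≤ Lam)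
    {n : ℕ} (N : Fin n) : ∃ κ : ℝ, 0 < κ ∧
      ∀ (p : ℝ) (u v g : EuclideanSpace ℝ (Fin n) → ℝ), 0 < p →
      ContinuousOn u {x | 0 ≤ x N} → ContinuousOn v {x | 0 ≤ x N} →
      (∀ x, 0 ≤ x N → 0 ≤ u x) → (∀ x, 0 ≤ x N → 0 ≤ v x) → (∀ x, 0 ≤ x N → 0 ≤ g x) →
      PucciMinSupersol lam Lam {x | 0 < x N} u (fun x => v x ^ p) →
      PucciMinSupersol lam Lam {x | 0 < x N} v g →
      ∀ (R : ℝ) (z y : EuclideanSpace ℝ (Fin n)) (m : ℝ), 0 < R → R ≤ z N →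
      y ∈ Metric.closedBall z (R / 2) → 0 < u y → 0 ≤ m →
      (∀ x ∈ Metric.closedBall z (R / 2), m ≤ v x) →
      (κ * m) ^ p ≤ 8 * Lam * n * u y / R ^ 2 := by
  have hn : 0 < n := N.pos
  have hL : 0 < Lam := hlam.trans_le hLam
  obtain ⟨σ, hσd⟩ : ∃ σ, σ = -(Lam * n / lam / 2) := ⟨_, rfl⟩
  have hσ : σ < 0 := by
    have : (0 : ℝ) < n := by exact_mod_cast hn
    have : 0 < Lam * n / lam / 2 := by positivity
    linarith
  have h34 : 1 < ((3 / 4 : ℝ) ^ 2) ^ σ :=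
    Real.one_lt_rpow_of_pos_of_lt_one_of_neg (by norm_num) (by norm_num) hσ
  have h12 : ((3 / 4 : ℝ) ^ 2) ^ σ < ((1 / 2 : ℝ) ^ 2) ^ σ :=
    Real.rpow_lt_rpow_of_neg (by norm_num) (by norm_num) hσ
  refine ⟨(((3 / 4 : ℝ) ^ 2) ^ σ - 1) / (((1 / 2 : ℝ) ^ 2) ^ σ - 1),
    div_pos (by linarith) (by linarith), ?_⟩
  intro p u v g hp hu hv hu0 hv0 hg hsu hsv R z y m hR hRz hy huy hm hmv
  obtain ⟨x, hx, hgx⟩ := hsu.exists_rhs_le hLam hR (ball_subset_halfspace hRz)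
    (hu.mono (closedBall_subset_halfspace hRz))
    (fun w hw => hu0 w (closedBall_subset_halfspace hRz hw)) hy huy
  refine le_trans (Real.rpow_le_rpow ?_ ?_ hp.le) hgx
  · exact mul_nonneg (div_pos (by linarith) (by linarith)).le hm
  · have hxR := mem_ball_iff_norm.1 hx
    rcases le_total ‖x - z‖ (R / 2) with hxs | hxs
    · refine le_trans ?_ (hmv x (mem_closedBall_iff_norm.2 hxs))
      refine mul_le_of_le_one_left hm ((div_le_one (by linarith)).2 (by linarith))
    · have h1 := hsv.radial_lower_bound hlam hLam hn (half_pos hR) (half_lt_self hR) hm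
        (ball_subset_halfspace hRz) (hv.mono (closedBall_subset_halfspace hRz))
        (fun w hw => hv0 w (closedBall_subset_halfspace hRz hw))
        (fun w hw => hg w (le_of_lt (ball_subset_halfspace hRz hw))) hmv hxs (by linarith)
      rw [← hσd] at h1
      refine le_trans ?_ h1
      have hRσ : 0 < (R ^ 2) ^ σ := Real.rpow_pos_of_pos (by positivity) _
      have e1 : ((R / 2) ^ 2) ^ σ = ((1 / 2 : ℝ) ^ 2) ^ σ * (R ^ 2) ^ σ := by
        rw [← Real.mul_rpow (by positivity) (by positivity)]
        congr 1
        ring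
      have e2 : ((3 / 4 : ℝ) ^ 2) ^ σ * (R ^ 2) ^ σ ≤ (‖x - z‖ ^ 2) ^ σ := by
        rw [← Real.mul_rpow (by positivity) (by positivity)]
        have h0 : 0 < ‖x - z‖ := (half_pos hR).trans_le hxs
        refine Real.rpow_le_rpow_of_nonpos (by positivity) ?_ hσ.le
        rw [← mul_pow]
        gcongr
      rw [e1]
      have hpos : 0 < ((1 / 2 : ℝ) ^ 2) ^ σ - 1 := by linarith
      have e3 : (((3 / 4 : ℝ) ^ 2) ^ σ - 1) / (((1 / 2 : ℝ) ^ 2) ^ σ - 1) * m =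
          m / (((1 / 2 : ℝ) ^ 2) ^ σ * (R ^ 2) ^ σ - (R ^ 2) ^ σ) *
            (((3 / 4 : ℝ) ^ 2) ^ σ * (R ^ 2) ^ σ - (R ^ 2) ^ σ) := by
        rw [← sub_one_mul, ← sub_one_mul]
        field_simp
      rw [e3]
      have hden : 0 ≤ m / (((1 / 2 : ℝ) ^ 2) ^ σ * (R ^ 2) ^ σ - (R ^ 2) ^ σ) := by
        rw [← sub_one_mul]
        positivity
      gcongr

lemma sq_rpow_neg_half {r : ℝ} (hr : 0 ≤ r) (γ : ℝ) : (r ^ 2) ^ (-(γ / 2)) = r ^ (-γ) := by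
  rw [← Real.rpow_natCast, ← Real.rpow_mul hr]
  congr 1
  push_cast
  ring

lemma apply_le_norm {n : ℕ} (x : EuclideanSpace ℝ (Fin n)) (N : Fin n) : x N ≤ ‖x‖ :=
  (le_abs_self _).trans (by simpa using PiLp.norm_apply_le x N)

/-- Comparison of a supersolution with `xₙ^{ω+ε} |x|^{-γ}` in a half annulus. -/
lemma PucciMinSupersol.halfspace_barrier_le {lam Lam ω γ β ε c ρ : ℝ} (hlam : 0 < lam)
    (hLam : lam ≤ Lam) {n : ℕ} (hn : 2 ≤ n) (hω : lam * ω = Lam) (hγ : γ = ω * n + ω - 1)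
    (hβ : β = ω + ε) (hε : 0 ≤ ε) (hε' : ε ≤ 1 / 2) (hc : 0 < c) {N : Fin n}
    {u g : EuclideanSpace ℝ (Fin n) → ℝ} (h : PucciMinSupersol lam Lam {x | 0 < x N} u g)
    (hu : ContinuousOn u {x | 0 ≤ x N}) (hu0 : ∀ x, 0 ≤ x N → 0 ≤ u x)
    (huc : ∀ x, 0 ≤ x N → ‖x‖ = 1 → c ≤ u x) (hρ : 0 < ρ)
    (hg : ∀ x : EuclideanSpace ℝ (Fin n), 0 < x N → 1 < ‖x‖ → ‖x‖ < ρ →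
      0 < lam * (c * ((x N) ^ β * ‖x‖ ^ (-γ))) * ε * γ *
        (-(2 / ‖x‖ ^ 2) + β / ((γ + 2) * (x N) ^ 2)) + g x)
    {x : EuclideanSpace ℝ (Fin n)} (hx : 0 ≤ x N) (hx1 : 1 ≤ ‖x‖) (hxρ : ‖x‖ ≤ ρ) :
    c * ((x N) ^ β * ‖x‖ ^ (-γ) - ρ ^ (β - γ)) ≤ u x := by
  have hω1 : 1 ≤ ω := by
    by_contra! h
    nlinarith
  have hβ0 : 0 < β := by linarith
  have hproj : Continuous fun x : EuclideanSpace ℝ (Fin n) => x N :=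
    (EuclideanSpace.proj N : EuclideanSpace ℝ (Fin n) →L[ℝ] ℝ).continuous
  simp only [← sq_rpow_neg_half (norm_nonneg _) γ] at hg ⊢
  refine h.le_of_strict_subsol
    (K := Metric.closedBall 0 ρ ∩ ({x | 1 ≤ ‖x‖} ∩ {x | 0 ≤ x N}))
    (U := Metric.ball 0 ρ ∩ ({x | 1 < ‖x‖} ∩ {x | 0 < x N}))
    (φ := fun x => c * ((x N) ^ β * (‖x‖ ^ 2) ^ (-(γ / 2)) - ρ ^ (β - γ)))
    ((isCompact_closedBall 0 ρ).inter_right ((isClosed_le continuous_const continuous_norm).inter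
      (isClosed_le continuous_const hproj)))
    (Metric.isOpen_ball.inter ((isOpen_lt continuous_const continuous_norm).inter
      (isOpen_lt continuous_const hproj)))
    (fun x hx => ⟨Metric.ball_subset_closedBall hx.1, show 1 ≤ ‖x‖ from le_of_lt hx.2.1,
      show 0 ≤ x N from le_of_lt hx.2.2⟩)
    (fun x hx => hx.2.2) (hu.mono fun x hx => hx.2.2) ?_ ?_ ?_ ?_ x
    ⟨mem_closedBall_zero_iff.2 hxρ, hx1, hx⟩
  · have h1 : Continuous fun x : EuclideanSpace ℝ (Fin n) => (x N) ^ β :=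
      hproj.rpow_const fun _ => Or.inr hβ0.le
    refine continuousOn_const.mul ((h1.continuousOn.mul ?_).sub continuousOn_const)
    refine (continuous_norm.pow 2).continuousOn.rpow_const fun x hx => Or.inl ?_
    have h1 : 1 ≤ ‖x‖ := hx.2.1
    exact (pow_pos (by linarith) 2).ne'
  · intro x hx hxU
    have hx1 : 1 ≤ ‖x‖ := hx.2.1
    have hxN : 0 ≤ x N := hx.2.2
    have hxρ : ‖x‖ ≤ ρ := mem_closedBall_zero_iff.1 hx.1
    have hle : (x N) ^ β ≤ ‖x‖ ^ β := Real.rpow_le_rpow hxN (apply_le_norm x N) hβ0.le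
    have hρ0 : 0 < ρ ^ (β - γ) := Real.rpow_pos_of_pos hρ _
    simp only [sq_rpow_neg_half (norm_nonneg _) γ]
    rcases hxN.eq_or_lt with h0 | h0
    · rw [← h0, Real.zero_rpow hβ0.ne']
      refine le_trans ?_ (hu0 x hxN)
      nlinarith
    rcases hx1.eq_or_lt with h1 | h1
    · rw [← h1, Real.one_rpow] at hle
      refine le_trans ?_ (huc x hxN h1.symm)
      rw [← h1, Real.one_rpow]
      nlinarith
    · have h2 : ‖x‖ = ρ := by
        refine le_antisymm hxρ ?_
        by_contra! hlt
        exact hxU ⟨mem_ball_zero_iff.2 hlt, h1, h0⟩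
      refine le_trans ?_ (hu0 x hxN)
      rw [h2] at hle ⊢
      have h3 : (x N) ^ β * ρ ^ (-γ) ≤ ρ ^ (β - γ) := by
        rw [sub_eq_add_neg, Real.rpow_add hρ]
        gcongr
      nlinarith
  · exact fun x hx => contDiffAt_halfspace_barrier hx.2.2 _ _ _ _
  · intro x hx
    have h1 := pucciMin_hess_halfspace_barrier hlam hLam hn hω hγ hβ hε hε' hc (ρ ^ (β - γ))
      (N := N) (x := x) hx.2.2
    have h2 := hg x hx.2.2 hx.2.1 (mem_ball_zero_iff.1 hx.1)
    linarith

/-- Lower bound for positive supersolutions in the half space. -/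
lemma PucciMinSupersol.exists_lower_bound {lam Lam ω γ : ℝ} (hlam : 0 < lam)
    (hLam : lam ≤ Lam) {n : ℕ} (hn : 2 ≤ n) (hω : lam * ω = Lam) (hγ : γ = ω * n + ω - 1)
    {N : Fin n} {u g : EuclideanSpace ℝ (Fin n) → ℝ}
    (h : PucciMinSupersol lam Lam {x | 0 < x N} u g)
    (hu : ContinuousOn u {x | 0 ≤ x N}) (hu0 : ∀ x, 0 ≤ x N → 0 < u x)
    (hg : ∀ x, 0 ≤ x N → 0 < g x) :
    ∃ c : ℝ, 0 < c ∧ (∀ x, 0 ≤ x N → ‖x‖ = 1 → c ≤ u x) ∧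
      ∀ x, 0 ≤ x N → 1 ≤ ‖x‖ → c * ((x N) ^ ω * ‖x‖ ^ (-γ)) ≤ u x := by
  have hω1 : 1 ≤ ω := by
    by_contra! h
    nlinarith
  have hproj : Continuous fun x : EuclideanSpace ℝ (Fin n) => x N :=
    (EuclideanSpace.proj N : EuclideanSpace ℝ (Fin n) →L[ℝ] ℝ).continuous
  have hK : IsCompact (Metric.sphere (0 : EuclideanSpace ℝ (Fin n)) 1 ∩ {x | 0 ≤ x N}) :=
    (isCompact_sphere 0 1).inter_right (isClosed_le continuous_const hproj)
  obtain ⟨x₀, hx₀, hmin⟩ := hK.exists_isMinOn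
    ⟨EuclideanSpace.single N 1, by simp, by simp⟩ (hu.mono inter_subset_right)
  have huc : ∀ x, 0 ≤ x N → ‖x‖ = 1 → u x₀ ≤ u x := fun x hx hx1 =>
    hmin ⟨mem_sphere_zero_iff_norm.2 hx1, hx⟩
  refine ⟨u x₀, hu0 _ hx₀.2, huc, ?_⟩
  intro x hx hx1
  have hlim : Tendsto (fun ρ : ℝ => u x₀ * ((x N) ^ ω * ‖x‖ ^ (-γ) - ρ ^ (ω - γ))) atTop
      (𝓝 (u x₀ * ((x N) ^ ω * ‖x‖ ^ (-γ) - 0))) := by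
    refine (tendsto_const_nhds.sub ?_).const_mul _
    have h1 : ω - γ = -(γ - ω) := by ring
    rw [h1]
    refine tendsto_rpow_neg_atTop ?_
    have : (2 : ℝ) ≤ n := by exact_mod_cast hn
    nlinarith
  rw [sub_zero] at hlim
  refine le_of_tendsto hlim ?_
  filter_upwards [eventually_ge_atTop ‖x‖] with ρ hρ
  refine h.halfspace_barrier_le hlam hLam hn hω hγ (ε := 0) (by simp) le_rfl (by norm_num)
    (hu0 _ hx₀.2) hu (fun x hx => (hu0 x hx).le) huc (by linarith) ?_ hx hx1 hρ
  intro y hy _ _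
  simpa using hg y hy.le

lemma rpow_le_barrier_of_mem_closedBall {n : ℕ} {N : Fin n} {R β γ : ℝ} (hR : 0 < R) (hβ : 0 ≤ β)
    (hγ : 0 ≤ γ) {x : EuclideanSpace ℝ (Fin n)}
    (hx : x ∈ Metric.closedBall (EuclideanSpace.single N R) (R / 2)) :
    R / 2 ≤ x N ∧ ‖x‖ ≤ 3 / 2 * R ∧
      (1 / 2) ^ β * (3 / 2) ^ (-γ) * R ^ (β - γ) ≤ (x N) ^ β * ‖x‖ ^ (-γ) := by
  have h1 := mem_closedBall_iff_norm.1 hx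
  have h2 := abs_le.1 (abs_apply_sub_le_norm x (EuclideanSpace.single N R) N)
  have h3 : R / 2 ≤ x N := by
    simp at h2
    linarith [h2.1]
  have h4 : ‖x‖ ≤ 3 / 2 * R := by
    have := norm_le_norm_add_norm_sub (EuclideanSpace.single N R) x
    simp only [PiLp.norm_single, Real.norm_eq_abs, abs_of_pos hR] at this
    rw [norm_sub_rev] at this
    linarith
  refine ⟨h3, h4, ?_⟩
  have h0 : 0 < ‖x‖ := (half_pos hR).trans_le (h3.trans (apply_le_norm x N))
  rw [sub_eq_add_neg, Real.rpow_add hR]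
  have h5 : (1 / 2 * R) ^ β ≤ (x N) ^ β := Real.rpow_le_rpow (by positivity) (by linarith) hβ
  have h6 : (3 / 2 * R) ^ (-γ) ≤ ‖x‖ ^ (-γ) :=
    Real.rpow_le_rpow_of_nonpos h0 h4 (by linarith)
  rw [Real.mul_rpow (by norm_num) hR.le] at h5 h6
  calc _ = (1 / 2) ^ β * R ^ β * ((3 / 2) ^ (-γ) * R ^ (-γ)) := by ring
    _ ≤ _ := by
      have : 0 ≤ x N := by linarith
      gcongr

/-- Upper bound on the decay of a positive solution of the system. -/
lemma exists_decay {lam Lam : ℝ} (hlam : 0 < lam) (hLam : lam ≤ Lam) {n : ℕ} {N : Fin n}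
    {p q : ℝ} (hp : 0 < p) (hq : 0 < q) {u v : EuclideanSpace ℝ (Fin n) → ℝ}
    (hu : ContinuousOn u {x | 0 ≤ x N}) (hv : ContinuousOn v {x | 0 ≤ x N})
    (hu0 : ∀ x, 0 ≤ x N → 0 < u x) (hv0 : ∀ x, 0 ≤ x N → 0 < v x)
    (hsu : PucciMinSupersol lam Lam {x | 0 < x N} u (fun x => v x ^ p))
    (hsv : PucciMinSupersol lam Lam {x | 0 < x N} v (fun x => u x ^ q)) :
    ∃ C : ℝ, 0 < C ∧ ∀ R : ℝ, 0 < R →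
      ∃ x ∈ Metric.closedBall (EuclideanSpace.single N R) (R / 2),
        u x ^ (p * q - 1) ≤ C * R ^ (-(2 * (p + 1))) := by
  obtain ⟨κ, hκ, hest⟩ := exists_interior_estimate hlam hLam N
  have hL : 0 < Lam := hlam.trans_le hLam
  have hn : (0 : ℝ) < n := by exact_mod_cast N.pos
  obtain ⟨D, hD⟩ : ∃ D, D = 8 * Lam * n := ⟨_, rfl⟩
  have hD0 : 0 < D := by rw [hD]; positivity
  have hκ' : 0 < (κ / D) ^ p * κ ^ (q * p) :=
    mul_pos (Real.rpow_pos_of_pos (div_pos hκ hD0) _) (Real.rpow_pos_of_pos hκ _)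
  refine ⟨D / ((κ / D) ^ p * κ ^ (q * p)), div_pos hD0 hκ', fun R hR => ?_⟩
  have hRz : R ≤ (EuclideanSpace.single N R : EuclideanSpace ℝ (Fin n)) N := by simp
  have hsub : Metric.closedBall (EuclideanSpace.single N R : EuclideanSpace ℝ (Fin n)) (R / 2) ⊆
      {x | 0 ≤ x N} := closedBall_subset_halfspace (by simp; linarith)
  have hne : (Metric.closedBall (EuclideanSpace.single N R : EuclideanSpace ℝ (Fin n))
      (R / 2)).Nonempty := Metric.nonempty_closedBall.2 (half_pos hR).le
  obtain ⟨x, hx, hxm⟩ := (isCompact_closedBall _ _).exists_isMinOn hne (hu.mono hsub)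
  obtain ⟨y, hy, hym⟩ := (isCompact_closedBall _ _).exists_isMinOn hne (hv.mono hsub)
  have hux := hu0 x (hsub hx)
  have hvy := hv0 y (hsub hy)
  have h1 := hest p u v _ hp hu hv (fun x hx => (hu0 x hx).le) (fun x hx => (hv0 x hx).le)
    (fun x hx => Real.rpow_nonneg (hu0 x hx).le q) hsu hsv R _ x (v y) hR hRz hx hux hvy.le
    (fun w hw => hym hw)
  have h2 := hest q v u _ hq hv hu (fun x hx => (hv0 x hx).le) (fun x hx => (hu0 x hx).le)
    (fun x hx => Real.rpow_nonneg (hv0 x hx).le p) hsv hsu R _ y (u x) hR hRz hy hvy hux.le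
    (fun w hw => hxm hw)
  rw [← hD] at h1 h2
  refine ⟨x, hx, ?_⟩
  have h3 : κ / D * R ^ 2 * (κ * u x) ^ q ≤ κ * v y := by
    rw [le_div_iff₀ (by positivity)] at h2
    rw [div_mul_eq_mul_div, div_mul_eq_mul_div, div_le_iff₀ hD0]
    nlinarith
  have h4 : (κ / D * R ^ 2 * (κ * u x) ^ q) ^ p ≤ D * u x / R ^ 2 :=
    (Real.rpow_le_rpow (by positivity) h3 hp.le).trans h1
  rw [Real.mul_rpow (by positivity) (by positivity), Real.mul_rpow (by positivity) (by positivity),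
    ← Real.rpow_mul (by positivity), Real.mul_rpow hκ.le hux.le, ← Real.rpow_natCast,
    ← Real.rpow_mul hR.le] at h4
  have h5 : u x ^ (q * p) = u x ^ (p * q - 1) * u x := by
    rw [← Real.rpow_add_one hux.ne']
    congr 1
    ring
  have h6 : R ^ (-(2 * (p + 1))) * (R ^ (((2 : ℕ) : ℝ) * p) * R ^ ((2 : ℕ) : ℝ)) = 1 := by
    have he : -(2 * (p + 1)) + (((2 : ℕ) : ℝ) * p + ((2 : ℕ) : ℝ)) = 0 := by
      push_cast
      ring
    rw [← Real.rpow_add hR, ← Real.rpow_add hR, he, Real.rpow_zero]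
  have hR1 : 0 < R ^ (((2 : ℕ) : ℝ) * p) := Real.rpow_pos_of_pos hR _
  have hR2 : 0 < R ^ ((2 : ℕ) : ℝ) := Real.rpow_pos_of_pos hR _
  rw [h5, le_div_iff₀ hR2] at h4
  have h7 : u x ^ (p * q - 1) * ((κ / D) ^ p * κ ^ (q * p)) *
      (R ^ (((2 : ℕ) : ℝ) * p) * R ^ ((2 : ℕ) : ℝ)) ≤ D := by
    refine le_of_mul_le_mul_right ?_ hux
    calc _ = _ := by ring
      _ ≤ _ := h4
  rw [div_mul_eq_mul_div, le_div_iff₀ hκ']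
  have h8 : 0 ≤ R ^ (-(2 * (p + 1))) := Real.rpow_nonneg hR.le _
  calc _ = R ^ (-(2 * (p + 1))) * (u x ^ (p * q - 1) * ((κ / D) ^ p * κ ^ (q * p)) *
      (R ^ (((2 : ℕ) : ℝ) * p) * R ^ ((2 : ℕ) : ℝ))) := by
        linear_combination -(u x ^ (p * q - 1) * ((κ / D) ^ p * κ ^ (q * p))) * h6
    _ ≤ R ^ (-(2 * (p + 1))) * D := by gcongr
    _ = _ := by ring

/-- No positive solutions of the system in the subcritical range. -/
lemma false_of_subcritical {lam Lam ω : ℝ} (hlam : 0 < lam) (hLam : lam ≤ Lam) {n : ℕ}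
    (hn : 2 ≤ n) (hω : lam * ω = Lam) {N : Fin n} {p q : ℝ} (hp : 0 < p) (hq : 0 < q)
    {u v : EuclideanSpace ℝ (Fin n) → ℝ}
    (hu : ContinuousOn u {x | 0 ≤ x N}) (hv : ContinuousOn v {x | 0 ≤ x N})
    (hu0 : ∀ x, 0 ≤ x N → 0 < u x) (hv0 : ∀ x, 0 ≤ x N → 0 < v x)
    (hsu : PucciMinSupersol lam Lam {x | 0 < x N} u (fun x => v x ^ p))
    (hsv : PucciMinSupersol lam Lam {x | 0 < x N} v (fun x => u x ^ q))
    (ht : 0 ≤ p * q - 1) (hcrit : (ω * n - 1) * (p * q - 1) < 2 * (p + 1)) : False := by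
  have hω1 : 1 ≤ ω := by
    by_contra! h
    nlinarith
  have hn' : (2 : ℝ) ≤ n := by exact_mod_cast hn
  obtain ⟨γ, hγ⟩ : ∃ γ, γ = ω * n + ω - 1 := ⟨_, rfl⟩
  have hγ0 : 0 ≤ γ := by nlinarith
  obtain ⟨c, hc, -, hlow⟩ := hsu.exists_lower_bound hlam hLam hn hω hγ hu hu0
    fun x hx => Real.rpow_pos_of_pos (hv0 x hx) p
  obtain ⟨C, hC, hdec⟩ := exists_decay hlam hLam hp hq hu hv hu0 hv0 hsu hsv
  obtain ⟨c₂, hc₂⟩ : ∃ c₂ : ℝ, c₂ = (1 / 2) ^ ω * (3 / 2) ^ (-γ) := ⟨_, rfl⟩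
  have hc₂0 : 0 < c₂ := by rw [hc₂]; positivity
  have hK : 0 < (c * c₂) ^ (p * q - 1) := Real.rpow_pos_of_pos (mul_pos hc hc₂0) _
  have hbd : ∀ R : ℝ, 2 ≤ R →
      R ^ (2 * (p + 1) - (ω * n - 1) * (p * q - 1)) ≤ C / (c * c₂) ^ (p * q - 1) := by
    intro R hR2
    have hR : 0 < R := by linarith
    obtain ⟨x, hx, hux⟩ := hdec R hR
    obtain ⟨h1, -, h3⟩ := rpow_le_barrier_of_mem_closedBall hR (by linarith : 0 ≤ ω) hγ0 hx
    rw [← hc₂] at h3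
    have h4 : c * c₂ * R ^ (ω - γ) ≤ u x := by
      refine le_trans ?_ (hlow x (by linarith) (by linarith [apply_le_norm x N]))
      rw [mul_assoc]
      gcongr
    have h5 := (Real.rpow_le_rpow (by positivity) h4 ht).trans hux
    rw [Real.mul_rpow (by positivity) (by positivity), ← Real.rpow_mul hR.le] at h5
    rw [le_div_iff₀ hK]
    have h6 : R ^ (2 * (p + 1) - (ω * n - 1) * (p * q - 1)) =
        R ^ ((ω - γ) * (p * q - 1)) * R ^ (2 * (p + 1)) := by
      rw [← Real.rpow_add hR, hγ]
      congr 1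
      ring
    have h7 : R ^ (-(2 * (p + 1))) * R ^ (2 * (p + 1)) = 1 := by
      rw [← Real.rpow_add hR, neg_add_cancel, Real.rpow_zero]
    have h8 := mul_le_mul_of_nonneg_right h5 (Real.rpow_nonneg hR.le (2 * (p + 1)))
    rw [mul_assoc C, h7] at h8
    rw [h6]
    linarith
  have hlim := (tendsto_rpow_atTop (sub_pos.2 hcrit)).eventually_gt_atTop
    (C / (c * c₂) ^ (p * q - 1))
  obtain ⟨R, hR, hR2⟩ := (hlim.and (eventually_ge_atTop 2)).exists
  exact absurd (hbd R hR2) (not_le.2 hR)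

/-- Strict positivity of the source term generated by the critical barrier. -/
lemma barrier_rhs_pos {lam c d ω α γ β ε η p M ρ A r V : ℝ} (hlam : 0 < lam) (hc : 0 < c)
    (hd : 0 < d) (hω : 1 ≤ ω) (hγ : 0 < γ) (hp : 0 < p) (hγα : γ = α + ω) (hβ : β = ω + ε)
    (hε : 0 < ε) (hη : 0 < η) (hη2 : 2 * (γ + 2) * η ^ 2 = 1) (hαp : α * p = α + 2)
    (hsmall : 2 * lam * c * γ * M * ε < (d * η ^ ω) ^ p) (hρ : ρ ^ ε = M) (hA : 0 < A)
    (hAr : A ≤ r) (hrρ : r ≤ ρ) (hV : 0 < V) (hlow : d * (A ^ ω * r ^ (-γ)) ≤ V) :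
    0 < lam * (c * (A ^ β * r ^ (-γ))) * ε * γ * (-(2 / r ^ 2) + β / ((γ + 2) * A ^ 2)) +
      V ^ p := by
  have hr : 0 < r := by linarith
  have hVp : 0 < V ^ p := Real.rpow_pos_of_pos hV p
  have hβ1 : 1 ≤ β := by linarith
  by_cases hcase : 2 / r ^ 2 ≤ β / ((γ + 2) * A ^ 2)
  · exact add_pos_of_nonneg_of_pos (mul_nonneg (by positivity) (by linarith)) hVp
  rw [not_le, div_lt_div_iff₀ (by positivity) (by positivity)] at hcase
  have hηr : η * r ≤ A := by
    refine (sq_le_sq₀ (by positivity) hA.le).1 ?_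
    have h4 : r ^ 2 ≤ 2 * ((γ + 2) * A ^ 2) :=
      le_trans (le_mul_of_one_le_left (sq_nonneg r) hβ1) hcase.le
    calc (η * r) ^ 2 = η ^ 2 * r ^ 2 := by ring
      _ ≤ η ^ 2 * (2 * ((γ + 2) * A ^ 2)) := by gcongr
      _ = _ := by linear_combination A ^ 2 * hη2
  have hVlow : (d * η ^ ω) ^ p * r ^ (-α - 2) ≤ V ^ p := by
    have h4 : d * η ^ ω * r ^ (-α) ≤ V := by
      refine le_trans ?_ hlow
      have h5 : r ^ (-α) = r ^ ω * r ^ (-γ) := by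
        rw [← Real.rpow_add hr, hγα]
        congr 1
        ring
      rw [h5]
      calc _ = d * ((η * r) ^ ω * r ^ (-γ)) := by
            rw [Real.mul_rpow hη.le hr.le]
            ring
        _ ≤ _ := by gcongr
    have h6 := Real.rpow_le_rpow (by positivity) h4 hp.le
    rw [Real.mul_rpow (by positivity) (by positivity), ← Real.rpow_mul hr.le] at h6
    have h7 : -α * p = -α - 2 := by linear_combination -hαp
    rwa [h7] at h6
  have hBup : A ^ β * r ^ (-γ) * (2 / r ^ 2) ≤ 2 * (M * r ^ (-α - 2)) := by
    have h4 : r ^ (-α - 2) = r ^ (ω - γ) / r ^ 2 := by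
      rw [← Real.rpow_natCast, ← Real.rpow_sub hr, hγα]
      congr 1
      push_cast
      ring
    have h5 : A ^ β * r ^ (-γ) ≤ M * r ^ (ω - γ) := by
      calc _ ≤ r ^ β * r ^ (-γ) := by gcongr
        _ = r ^ ε * r ^ (ω - γ) := by
          rw [← Real.rpow_add hr, ← Real.rpow_add hr, hβ]
          congr 1
          ring
        _ ≤ ρ ^ ε * r ^ (ω - γ) := by gcongr
        _ = _ := by rw [hρ]
    rw [h4]
    calc _ ≤ M * r ^ (ω - γ) * (2 / r ^ 2) := by gcongr
      _ = _ := by ring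
  have h4 : lam * c * ε * γ * (A ^ β * r ^ (-γ) * (2 / r ^ 2)) ≤
      lam * c * ε * γ * (2 * (M * r ^ (-α - 2))) := by gcongr
  have h5 := mul_lt_mul_of_pos_right hsmall (Real.rpow_pos_of_pos hr (-α - 2))
  have h6 : 0 ≤ lam * c * ε * γ * (A ^ β * r ^ (-γ)) * (β / ((γ + 2) * A ^ 2)) := by positivity
  calc 0 < (d * η ^ ω) ^ p * r ^ (-α - 2) -
          lam * c * ε * γ * (2 * (M * r ^ (-α - 2))) := by linarith
    _ ≤ lam * c * ε * γ * (A ^ β * r ^ (-γ)) * (β / ((γ + 2) * A ^ 2)) + V ^ p -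
        lam * c * ε * γ * (A ^ β * r ^ (-γ) * (2 / r ^ 2)) := by linarith
    _ = _ := by ring

/-- No positive solutions of the system in the critical case. -/
lemma false_of_critical {lam Lam ω : ℝ} (hlam : 0 < lam) (hLam : lam ≤ Lam) {n : ℕ}
    (hn : 2 ≤ n) (hω : lam * ω = Lam) {N : Fin n} {p : ℝ} (hp : 1 < p)
    {u v : EuclideanSpace ℝ (Fin n) → ℝ}
    (hu : ContinuousOn u {x | 0 ≤ x N}) (hv : ContinuousOn v {x | 0 ≤ x N})
    (hu0 : ∀ x, 0 ≤ x N → 0 < u x) (hv0 : ∀ x, 0 ≤ x N → 0 < v x)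
    (hsu : PucciMinSupersol lam Lam {x | 0 < x N} u (fun x => v x ^ p))
    (hsv : PucciMinSupersol lam Lam {x | 0 < x N} v (fun x => u x ^ p))
    (hcrit : (ω * n - 1) * (p - 1) = 2) : False := by
  have hω1 : 1 ≤ ω := by
    by_contra! h
    nlinarith
  have hp0 : 0 < p := by linarith
  have hn' : (2 : ℝ) ≤ n := by exact_mod_cast hn
  obtain ⟨α, hα⟩ : ∃ α, α = ω * n - 1 := ⟨_, rfl⟩
  rw [← hα] at hcrit
  have hα1 : 1 ≤ α := by nlinarith
  obtain ⟨γ, hγ⟩ : ∃ γ, γ = ω * n + ω - 1 := ⟨_, rfl⟩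
  have hγα : γ = α + ω := by rw [hγ, hα]; ring
  have hγ0 : 0 < γ := by linarith
  have ht : 0 < p * p - 1 := by nlinarith
  obtain ⟨c, hc, huc, -⟩ := hsu.exists_lower_bound hlam hLam hn hω hγ hu hu0
    fun x hx => Real.rpow_pos_of_pos (hv0 x hx) p
  obtain ⟨d, hd, -, hlow⟩ := hsv.exists_lower_bound hlam hLam hn hω hγ hv hv0
    fun x hx => Real.rpow_pos_of_pos (hu0 x hx) p
  obtain ⟨C, hC, hdec⟩ := exists_decay hlam hLam hp0 hp0 hu hv hu0 hv0 hsu hsv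
  have hdec' : ∀ R : ℝ, 0 < R → ∃ x ∈ Metric.closedBall (EuclideanSpace.single N R) (R / 2),
      u x ≤ C ^ (p * p - 1)⁻¹ * R ^ (-α) := by
    intro R hR
    obtain ⟨x, hx, hux⟩ := hdec R hR
    refine ⟨x, hx, ?_⟩
    by_contra! hlt
    have h1 := (Real.rpow_lt_rpow (by positivity) hlt ht).trans_le hux
    rw [Real.mul_rpow (by positivity) (by positivity), Real.rpow_inv_rpow hC.le ht.ne',
      ← Real.rpow_mul hR.le] at h1
    have h2 : -α * (p * p - 1) = -(2 * (p + 1)) := by linear_combination -(p + 1) * hcrit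
    rw [h2] at h1
    exact lt_irrefl _ h1
  obtain ⟨c₂, hc₂⟩ : ∃ c₂ : ℝ, c₂ = (1 / 2) ^ (ω + 1) * (3 / 2) ^ (-γ) := ⟨_, rfl⟩
  have hc₂0 : 0 < c₂ := by rw [hc₂]; positivity
  obtain ⟨L, hL2, hL⟩ : ∃ L : ℝ, 2 ≤ L ∧ C ^ (p * p - 1)⁻¹ < c * (c₂ * L - 1) := by
    refine ⟨max 2 ((C ^ (p * p - 1)⁻¹ / c + 2) / c₂), le_max_left _ _, ?_⟩
    have h1 : C ^ (p * p - 1)⁻¹ / c + 2 ≤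
        c₂ * max 2 ((C ^ (p * p - 1)⁻¹ / c + 2) / c₂) := by
      rw [mul_comm c₂, ← div_le_iff₀ hc₂0]
      exact le_max_right _ _
    rw [← div_lt_iff₀' hc]
    linarith
  obtain ⟨η, hη⟩ : ∃ η : ℝ, η = √(2 * (γ + 2))⁻¹ := ⟨_, rfl⟩
  have hη0 : 0 < η := by rw [hη]; exact Real.sqrt_pos.2 (by positivity)
  have hη2 : 2 * (γ + 2) * η ^ 2 = 1 := by
    rw [hη, Real.sq_sqrt (by positivity)]
    field_simp
  obtain ⟨c₁, hc₁⟩ : ∃ c₁ : ℝ, c₁ = (d * η ^ ω) ^ p := ⟨_, rfl⟩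
  have hc₁0 : 0 < c₁ := by rw [hc₁]; positivity
  have hL0 : 0 < L := by linarith
  obtain ⟨ε, hε0, hε1, hε2⟩ : ∃ ε : ℝ, 0 < ε ∧ ε ≤ 1 / 2 ∧
      2 * lam * c * γ * L ^ 2 * ε < c₁ := by
    have hM : 0 < 2 * lam * c * γ * L ^ 2 := by positivity
    refine ⟨min (1 / 2) (c₁ / (2 * (2 * lam * c * γ * L ^ 2))), by positivity, min_le_left _ _, ?_⟩
    rw [← lt_div_iff₀' hM]
    refine (min_le_right _ _).trans_lt ?_
    exact div_lt_div_of_pos_left hc₁0 hM (by linarith)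
  obtain ⟨β, hβ⟩ : ∃ β, β = ω + ε := ⟨_, rfl⟩
  obtain ⟨R, hR⟩ : ∃ R, R = L ^ ε⁻¹ := ⟨_, rfl⟩
  have hRε : R ^ ε = L := by rw [hR, Real.rpow_inv_rpow hL0.le hε0.ne']
  have hR2 : 2 ≤ R := by
    refine hL2.trans ?_
    rw [hR]
    refine Real.self_le_rpow_of_one_le (by linarith) ?_
    rw [one_le_inv₀ hε0]
    linarith
  have hR0 : 0 < R := by linarith
  have hρε : (R ^ 2) ^ ε = L ^ 2 := by
    rw [← hRε, ← Real.rpow_natCast, ← Real.rpow_natCast, ← Real.rpow_mul hR0.le,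
      ← Real.rpow_mul hR0.le, mul_comm]
  obtain ⟨x, hx, hux⟩ := hdec' R hR0
  obtain ⟨h1, h2, h3⟩ := rpow_le_barrier_of_mem_closedBall hR0 (by linarith : 0 ≤ β) hγ0.le hx
  have hbar := hsu.halfspace_barrier_le hlam hLam hn hω hγ hβ hε0.le hε1 hc hu
    (fun x hx => (hu0 x hx).le) huc (ρ := R ^ 2) (by positivity) ?_ (x := x) (by linarith)
    (by linarith [apply_le_norm x N]) (by nlinarith)
  · have h4 : R ^ (β - γ) = L * R ^ (-α) := by
      rw [← hRε, ← Real.rpow_add hR0, hβ, hγα]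
      congr 1
      ring
    have h5 : (R ^ 2) ^ (β - γ) ≤ R ^ (-α) := by
      rw [← Real.rpow_natCast, ← Real.rpow_mul hR0.le, hβ, hγα]
      refine Real.rpow_le_rpow_of_exponent_le (by linarith) ?_
      push_cast
      linarith
    have h6 : c₂ ≤ (1 / 2) ^ β * (3 / 2) ^ (-γ) := by
      rw [hc₂]
      refine mul_le_mul_of_nonneg_right ?_ (by positivity)
      exact Real.rpow_le_rpow_of_exponent_ge (by norm_num) (by norm_num) (by linarith)
    have hRα : 0 < R ^ (-α) := Real.rpow_pos_of_pos hR0 _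
    rw [h4] at h3
    have h7 : c₂ * (L * R ^ (-α)) ≤ (x N) ^ β * ‖x‖ ^ (-γ) := le_trans (by gcongr) h3
    have h8 : c * (c₂ * (L * R ^ (-α)) - R ^ (-α)) ≤ u x := le_trans (by gcongr) hbar
    have h9 : c * (c₂ * (L * R ^ (-α)) - R ^ (-α)) = c * (c₂ * L - 1) * R ^ (-α) := by ring
    have h10 := mul_lt_mul_of_pos_right hL hRα
    linarith
  · intro y hy hy1 hyρ
    rw [hc₁] at hε2
    exact barrier_rhs_pos hlam hc hd (by linarith) hγ0 (by linarith) hγα hβ hε0 hη0 hη2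
      (by linear_combination hcrit) hε2 hρε hy (apply_le_norm y N) hyρ.le (hv0 y hy.le)
      (hlow y hy.le hy1.le)

/-- A nonnegative supersolution vanishing in the half space forces the right-hand side to be
nonpositive. -/
lemma PucciMinSupersol.rhs_nonpos_of_eq_zero {lam Lam : ℝ} (hLam : lam ≤ Lam) {n : ℕ}
    {Ω : Set (EuclideanSpace ℝ (Fin n))} (hΩ : IsOpen Ω) {u g : EuclideanSpace ℝ (Fin n) → ℝ}
    (h : PucciMinSupersol lam Lam Ω u g) (hu : ∀ x ∈ Ω, u x = 0)
    {x : EuclideanSpace ℝ (Fin n)} (hx : x ∈ Ω) : g x ≤ 0 := by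
  have h1 := h x hx (fun y => -(0 * ‖y - x‖ ^ 2))
    ((contDiff_const.mul ((contDiff_id.sub contDiff_const).norm_sq ℝ)).neg) ?_
  · have h2 := pucciMin_hess_neg_norm_sq hLam le_rfl x x
    linarith
  · filter_upwards [hΩ.mem_nhds hx] with y hy
    simp [hu y hy, hu x hx]

/-- The system has no solution which is positive in the open half space. -/
lemma false_of_pos {n : ℕ} (hn : 2 ≤ n) {lam Lam : ℝ} (hlam : 0 < lam) (hLam : lam ≤ Lam)
    {p q : ℝ} (hp : 0 < p) (hq : 0 < q)
    (hcrit :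
      (1 < p * q ∧ (Lam * (n : ℝ) / lam - 1 < 2 * (p + 1) / (p * q - 1) ∨
        Lam * (n : ℝ) / lam - 1 < 2 * (q + 1) / (p * q - 1))) ∨
      (2 * (p + 1) / (p * q - 1) = Lam * (n : ℝ) / lam - 1 ∧
        2 * (q + 1) / (p * q - 1) = Lam * (n : ℝ) / lam - 1) ∨
      p * q = 1)
    {N : Fin n} {u v : EuclideanSpace ℝ (Fin n) → ℝ}
    (hu : ContinuousOn u {x | 0 ≤ x N}) (hv : ContinuousOn v {x | 0 ≤ x N})
    (hu0 : ∀ x, 0 < x N → 0 < u x) (hv0 : ∀ x, 0 < x N → 0 < v x)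
    (hsu : PucciMinSupersol lam Lam {x | 0 < x N} u (fun x => v x ^ p))
    (hsv : PucciMinSupersol lam Lam {x | 0 < x N} v (fun x => u x ^ q)) : False := by
  obtain ⟨ω, hω'⟩ : ∃ ω, ω = Lam / lam := ⟨_, rfl⟩
  have hω : lam * ω = Lam := by rw [hω']; field_simp
  have hωn : Lam * (n : ℝ) / lam - 1 = ω * n - 1 := by rw [hω']; ring
  have hn' : (2 : ℝ) ≤ n := by exact_mod_cast hn
  have hα : 0 < ω * n - 1 := by
    have : 1 ≤ ω := by
      rw [hω', one_le_div hlam]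
      exact hLam
    nlinarith
  rw [hωn] at hcrit
  obtain ⟨a, ha⟩ : ∃ a : EuclideanSpace ℝ (Fin n), a = EuclideanSpace.single N 1 := ⟨_, rfl⟩
  have haN : ∀ x : EuclideanSpace ℝ (Fin n), (x + a) N = x N + 1 := by
    intro x
    simp [ha]
  have hmaps : MapsTo (fun x => x + a) {x : EuclideanSpace ℝ (Fin n) | 0 ≤ x N} {x | 0 ≤ x N} := by
    intro x hx
    have hx' : 0 ≤ x N := hx
    show 0 ≤ (x + a) N
    rw [haN]
    linarith
  have hcont : ContinuousOn (fun x => x + a) {x : EuclideanSpace ℝ (Fin n) | 0 ≤ x N} :=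
    (continuous_id.add continuous_const).continuousOn
  have hu' : ContinuousOn (fun x => u (x + a)) {x | 0 ≤ x N} := hu.comp hcont hmaps
  have hv' : ContinuousOn (fun x => v (x + a)) {x | 0 ≤ x N} := hv.comp hcont hmaps
  have hu0' : ∀ x, 0 ≤ x N → 0 < u (x + a) := fun x hx => hu0 _ (by rw [haN]; linarith)
  have hv0' : ∀ x, 0 ≤ x N → 0 < v (x + a) := fun x hx => hv0 _ (by rw [haN]; linarith)
  have hΩ : ∀ x ∈ {x : EuclideanSpace ℝ (Fin n) | 0 < x N}, x + a ∈
      {x : EuclideanSpace ℝ (Fin n) | 0 < x N} := by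
    intro x hx
    have hx' : 0 < x N := hx
    show 0 < (x + a) N
    rw [haN]
    linarith
  have hsu' := hsu.translate a hΩ
  have hsv' := hsv.translate a hΩ
  rcases hcrit with ⟨hpq, hc | hc⟩ | ⟨hcp, hcq⟩ | hpq
  · rw [lt_div_iff₀ (by linarith)] at hc
    exact false_of_subcritical hlam hLam hn hω hp hq hu' hv' hu0' hv0' hsu' hsv' (by linarith) hc
  · rw [mul_comm p q] at hpq hc
    rw [lt_div_iff₀ (by linarith)] at hc
    exact false_of_subcritical hlam hLam hn hω hq hp hv' hu' hv0' hu0' hsv' hsu' (by linarith) hc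
  · have ht : 0 < p * q - 1 := by
      by_contra! ht
      have : 2 * (p + 1) / (p * q - 1) ≤ 0 := div_nonpos_of_nonneg_of_nonpos (by linarith) ht
      linarith
    rw [div_eq_iff ht.ne'] at hcp hcq
    obtain rfl : p = q := by linarith
    have hp1 : 1 < p := by nlinarith
    refine false_of_critical hlam hLam hn hω hp1 hu' hv' hu0' hv0' hsu' hsv' ?_
    refine mul_right_cancel₀ (by linarith : p + 1 ≠ 0) ?_
    linear_combination -hcp
  · refine false_of_subcritical hlam hLam hn hω hp hq hu' hv' hu0' hv0' hsu' hsv' (by linarith) ?_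
    rw [hpq]
    linarith

/-- A continuous function vanishing in the open half space vanishes on its closure. -/
lemma eq_zero_of_eq_zero_halfspace {n : ℕ} {N : Fin n} {u : EuclideanSpace ℝ (Fin n) → ℝ}
    (hu : ContinuousOn u {x | 0 ≤ x N}) (hu0 : ∀ x, 0 < x N → u x = 0)
    {x : EuclideanSpace ℝ (Fin n)} (hx : 0 ≤ x N) : u x = 0 := by
  have hN : ∀ t : ℝ, (x + EuclideanSpace.single N t) N = x N + t := by
    intro t
    simp
  have hpath : Continuous fun t : ℝ => x + EuclideanSpace.single N t := by
    have : (fun t : ℝ => x + EuclideanSpace.single N t) =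
        fun t => x + t • EuclideanSpace.single N (1 : ℝ) := by
      ext t i
      simp [PiLp.single_apply]
    rw [this]
    fun_prop
  have hlim : Tendsto (fun t : ℝ => x + EuclideanSpace.single N t) (𝓝[>] 0)
      (𝓝[{x | 0 ≤ x N}] x) := by
    refine tendsto_nhdsWithin_iff.2 ⟨?_, ?_⟩
    · have := hpath.tendsto 0
      have h0 : EuclideanSpace.single N (0 : ℝ) = 0 := by
        ext i
        simp [PiLp.single_apply]
      rw [h0, add_zero] at this
      exact this.mono_left nhdsWithin_le_nhds
    · filter_upwards [self_mem_nhdsWithin] with t ht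
      have ht' : 0 < t := ht
      show 0 ≤ (x + EuclideanSpace.single N t) N
      rw [hN]
      linarith
  have h1 := (hu x hx).tendsto.comp hlim
  have h2 : u ∘ (fun t : ℝ => x + EuclideanSpace.single N t) =ᶠ[𝓝[>] 0] fun _ => 0 := by
    filter_upwards [self_mem_nhdsWithin] with t ht
    have ht' : 0 < t := ht
    exact hu0 _ (by rw [hN]; linarith)
  exact tendsto_nhds_unique (h1.congr' h2) tendsto_const_nhds

theorem stmt10 (n : ℕ) (hn : 2 ≤ n) (lam Lam : ℝ) (hlam : 0 < lam) (hLam : lam ≤ Lam)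
    (p q : ℝ) (hp : 0 < p) (hq : 0 < q)
    (hcrit :
      (1 < p * q ∧ (Lam * (n : ℝ) / lam - 1 < 2 * (p + 1) / (p * q - 1) ∨
        Lam * (n : ℝ) / lam - 1 < 2 * (q + 1) / (p * q - 1))) ∨
      (2 * (p + 1) / (p * q - 1) = Lam * (n : ℝ) / lam - 1 ∧
        2 * (q + 1) / (p * q - 1) = Lam * (n : ℝ) / lam - 1) ∨
      p * q = 1)
    (u v : EuclideanSpace ℝ (Fin n) → ℝ)
    (hu : ContinuousOn u {x | 0 ≤ x ⟨n - 1, by omega⟩})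
    (hv : ContinuousOn v {x | 0 ≤ x ⟨n - 1, by omega⟩})
    (hunonneg : ∀ x : EuclideanSpace ℝ (Fin n), 0 ≤ x ⟨n - 1, by omega⟩ → 0 ≤ u x)
    (hvnonneg : ∀ x : EuclideanSpace ℝ (Fin n), 0 ≤ x ⟨n - 1, by omega⟩ → 0 ≤ v x)
    (hsuperu : PucciMinSupersol lam Lam {x | 0 < x ⟨n - 1, by omega⟩} u (fun x => v x ^ p))
    (hsuperv : PucciMinSupersol lam Lam {x | 0 < x ⟨n - 1, by omega⟩} v (fun x => u x ^ q)) :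
    ∀ x : EuclideanSpace ℝ (Fin n), 0 ≤ x ⟨n - 1, by omega⟩ → u x = 0 ∧ v x = 0 := by
  obtain ⟨N, hN⟩ : ∃ N : Fin n, N = ⟨n - 1, by omega⟩ := ⟨_, rfl⟩
  simp only [← hN] at hu hv hunonneg hvnonneg hsuperu hsuperv ⊢
  have hproj : Continuous fun x : EuclideanSpace ℝ (Fin n) => x N :=
    (EuclideanSpace.proj N : EuclideanSpace ℝ (Fin n) →L[ℝ] ℝ).continuous
  have hΩ : IsOpen {x : EuclideanSpace ℝ (Fin n) | 0 < x N} := isOpen_lt continuous_const hproj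
  have hvp : ∀ x : EuclideanSpace ℝ (Fin n), 0 ≤ x N → 0 ≤ v x ^ p :=
    fun x hx => Real.rpow_nonneg (hvnonneg x hx) p
  have huq : ∀ x : EuclideanSpace ℝ (Fin n), 0 ≤ x N → 0 ≤ u x ^ q :=
    fun x hx => Real.rpow_nonneg (hunonneg x hx) q
  have hmain : ∀ x y : EuclideanSpace ℝ (Fin n), 0 < x N → 0 < u x → 0 < y N → 0 < v y → False :=
    fun x y hx hux hy hvy => false_of_pos hn hlam hLam hp hq hcrit hu hv
      (hsuperu.pos_of_pos hlam hLam hu hunonneg hvp hx hux)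
      (hsuperv.pos_of_pos hlam hLam hv hvnonneg huq hy hvy) hsuperu hsuperv
  have hu0 : ∀ x : EuclideanSpace ℝ (Fin n), 0 < x N → u x = 0 := by
    intro x hx
    by_contra hne
    have hux : 0 < u x := lt_of_le_of_ne (hunonneg x hx.le) (Ne.symm hne)
    have hv0 : ∀ y ∈ {y : EuclideanSpace ℝ (Fin n) | 0 < y N}, v y = 0 := by
      intro y hy
      by_contra hne
      exact hmain x y hx hux hy (lt_of_le_of_ne (hvnonneg y (le_of_lt hy)) (Ne.symm hne))
    exact absurd (hsuperv.rhs_nonpos_of_eq_zero hLam hΩ hv0 hx)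
      (not_le.2 (Real.rpow_pos_of_pos hux q))
  have hv0 : ∀ x : EuclideanSpace ℝ (Fin n), 0 < x N → v x = 0 := by
    intro x hx
    by_contra hne
    have hvx : 0 < v x := lt_of_le_of_ne (hvnonneg x hx.le) (Ne.symm hne)
    exact absurd (hsuperu.rhs_nonpos_of_eq_zero hLam hΩ hu0 hx)
      (not_le.2 (Real.rpow_pos_of_pos hvx p))
  exact fun x hx => ⟨eq_zero_of_eq_zero_halfspace hu hu0 hx, eq_zero_of_eq_zero_halfspace hv hv0 hx⟩
end

section
/- Let n ≥ 2, 0 < λ ≤ Λ, and ñ = (λ/Λ)(n−1) + 1. Let u : closure of ℝⁿ₊ → [0,∞) be lower semicontinuous and satisfy M⁺_{λ,Λ}(D²u) ≤ 0 in the viscosity sense in ℝⁿ₊, and define m_u(r) = inf { u(x)/xₙ : x ∈ ℝⁿ₊, |x| < r } for r > 0. Then for every 0 < r < R and every ρ with r ≤ ρ ≤ R, one has m_u(ρ) ≥ [ m_u(r)(ρ^{−ñ} − R^{−ñ}) + m_u(R)(r^{−ñ} − ρ^{−ñ}) ] / (r^{−ñ} − R^{−ñ}); that is, m_u is a concave function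 of r^{−ñ}. -/
open scoped BigOperators

/-- The Pucci maximal operator `M⁺_{λ,Λ}`: for a symmetric matrix it equals
`Λ · (sum of positive eigenvalues) + λ · (sum of negative eigenvalues)`. -/
noncomputable def pucciMax (lam Lam : ℝ) {n : ℕ} (M : Matrix (Fin n) (Fin n) ℝ) : ℝ :=
  if h : M.IsHermitian then
    ∑ i, (Lam * max (h.eigenvalues i) 0 + lam * min (h.eigenvalues i) 0)
  else 0

/-- `u` is a viscosity supersolution of `M⁺_{λ,Λ}(D²u) + g = 0` in `Ω`. -/
def PucciSupersol (lam Lam : ℝ) {n : ℕ} (Ω : Set (EuclideanSpace ℝ (Fin n)))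
    (u g : EuclideanSpace ℝ (Fin n) → ℝ) : Prop :=
  ∀ x₀ ∈ Ω, ∀ φ : EuclideanSpace ℝ (Fin n) → ℝ, ContDiff ℝ 2 φ →
    IsLocalMin (fun x => u x - φ x) x₀ → pucciMax lam Lam (hess φ x₀) + g x₀ ≤ 0


open Topology

/-- If a `C²` function agrees near `x` along the line `t ↦ x + t • v` with a function `h`, its second
derivative at `x` in the direction `v` is the second derivative of `h` at `0`. -/
theorem iteratedFDeriv_two_eq_of_line {E : Type*} [NormedAddCommGroup E] [NormedSpace ℝ E]
    {φ : E → ℝ} (hφ : ContDiff ℝ 2 φ) (x v : E) {h h' : ℝ → ℝ} {c : ℝ}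
    (heq : ∀ᶠ t in 𝓝 (0 : ℝ), φ (x + t • v) = h t)
    (hh : ∀ᶠ t in 𝓝 (0 : ℝ), HasDerivAt h (h' t) t) (hh' : HasDerivAt h' c 0) :
    iteratedFDeriv ℝ 2 φ x ![v, v] = c := by
  have hline : ∀ t : ℝ, HasDerivAt (fun t : ℝ => x + t • v) v t := fun t => by
    simpa using ((hasDerivAt_id t).smul_const v).const_add x
  have hfst : ∀ t : ℝ, HasDerivAt (fun t : ℝ => φ (x + t • v)) (fderiv ℝ φ (x + t • v) v) t :=
    fun t => ((hφ.differentiable (by norm_num)) _).hasFDerivAt.comp_hasDerivAt t (hline t)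
  have hd : Differentiable ℝ (fderiv ℝ φ) :=
    (hφ.fderiv_right (m := 1) (by norm_num)).differentiable (by norm_num)
  have hsnd : HasDerivAt (fun t : ℝ => fderiv ℝ φ (x + t • v) v) (fderiv ℝ (fderiv ℝ φ) x v v) 0 := by
    have h1 := (hd (x + (0 : ℝ) • v)).hasFDerivAt.comp_hasDerivAt 0 (hline 0)
    have h2 := h1.clm_apply (hasDerivAt_const (0 : ℝ) v)
    simpa using h2
  have hcongr : h' =ᶠ[𝓝 (0 : ℝ)] fun t => fderiv ℝ φ (x + t • v) v := by
    filter_upwards [hh, eventually_eventually_nhds.2 heq] with t ht hte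
    exact (ht.congr_of_eventuallyEq hte).unique (hfst t)
  rw [iteratedFDeriv_two_apply]
  exact hsnd.unique (hh'.congr_of_eventuallyEq hcongr.symm)

/-- The Pucci maximal operator dominates the linear operator with coefficient matrix
`lam • 1 + (Lam - lam) • v vᵀ`, for a vector `v` of norm at most one. -/
theorem le_pucciMax {n : ℕ} {lam Lam : ℝ} (hLam : lam ≤ Lam) {M : Matrix (Fin n) (Fin n) ℝ}
    (hM : M.IsHermitian) {v : EuclideanSpace ℝ (Fin n)} (hv : ‖v‖ ≤ 1) :
    lam * M.trace + (Lam - lam) * (v.ofLp ⬝ᵥ M.mulVec v.ofLp) ≤ pucciMax lam Lam M := by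
  have hsymm := Matrix.isSymmetric_toEuclideanLin_iff.2 hM
  have hquad : v.ofLp ⬝ᵥ M.mulVec v.ofLp =
      ∑ i, hM.eigenvalues i * (inner ℝ (hM.eigenvectorBasis i) v) ^ 2 := by
    have h1 : v.ofLp ⬝ᵥ M.mulVec v.ofLp = inner ℝ v (Matrix.toEuclideanLin M v) := by
      rw [Matrix.toLpLin_apply, EuclideanSpace.inner_eq_star_dotProduct]
      simp [dotProduct_comm]
    rw [h1, ← hM.eigenvectorBasis.sum_inner_mul_inner]
    refine Finset.sum_congr rfl fun i _ => ?_
    have h2 : Matrix.toEuclideanLin M (hM.eigenvectorBasis i) =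
        hM.eigenvalues i • hM.eigenvectorBasis i := by
      rw [Matrix.toLpLin_apply, hM.mulVec_eigenvectorBasis]
      rfl
    rw [← hsymm, h2, real_inner_smul_left, real_inner_comm v]
    ring
  have hle : v.ofLp ⬝ᵥ M.mulVec v.ofLp ≤ ∑ i, max (hM.eigenvalues i) 0 := by
    rw [hquad]
    refine Finset.sum_le_sum fun i _ => ?_
    have h1 : (inner ℝ (hM.eigenvectorBasis i) v) ^ 2 ≤ 1 := by
      rw [sq_le_one_iff_abs_le_one]
      refine (abs_real_inner_le_norm _ _).trans ?_
      simpa using hv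
    calc _ ≤ max (hM.eigenvalues i) 0 * (inner ℝ (hM.eigenvectorBasis i) v) ^ 2 := by
          gcongr; exact le_max_left _ _
      _ ≤ max (hM.eigenvalues i) 0 * 1 := by gcongr
      _ = _ := mul_one _
  rw [pucciMax, dif_pos hM, hM.trace_eq_sum_eigenvalues]
  have hsum : ∑ i, (Lam * max (hM.eigenvalues i) 0 + lam * min (hM.eigenvalues i) 0) =
      lam * ∑ i, hM.eigenvalues i + (Lam - lam) * ∑ i, max (hM.eigenvalues i) 0 := by
    rw [Finset.mul_sum, Finset.mul_sum, ← Finset.sum_add_distrib]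
    refine Finset.sum_congr rfl fun i _ => ?_
    linear_combination lam * max_add_min (hM.eigenvalues i) 0
  rw [hsum]
  simp only [RCLike.ofReal_real_eq_id, id]
  gcongr

theorem isHermitian_hess {n : ℕ} {φ : EuclideanSpace ℝ (Fin n) → ℝ} (hφ : ContDiff ℝ 2 φ)
    (x : EuclideanSpace ℝ (Fin n)) : (hess φ x).IsHermitian := by
  ext i j
  simp only [Matrix.conjTranspose_apply, hess, iteratedFDeriv_two_apply, star_trivial]
  exact (hφ.contDiffAt.isSymmSndFDerivAt (by simp)).eq _ _

theorem dotProduct_hess_mulVec {n : ℕ} (φ : EuclideanSpace ℝ (Fin n) → ℝ)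
    (x v : EuclideanSpace ℝ (Fin n)) :
    v.ofLp ⬝ᵥ (hess φ x).mulVec v.ofLp = iteratedFDeriv ℝ 2 φ x ![v, v] := by
  have hv : v = ∑ i, v i • EuclideanSpace.single i (1 : ℝ) := by
    simpa using ((EuclideanSpace.basisFun (Fin n) ℝ).sum_repr v).symm
  rw [iteratedFDeriv_two_apply]
  conv_rhs => rw [hv]
  simp only [Matrix.cons_val_zero, Matrix.cons_val_one, map_sum, map_smul,
    sum_apply, smul_apply, dotProduct, Matrix.mulVec, hess,
    iteratedFDeriv_two_apply, smul_eq_mul, Finset.mul_sum]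
  rw [Finset.sum_comm]
  refine Finset.sum_congr rfl fun i _ => Finset.sum_congr rfl fun j _ => ?_
  ring

/-- A function that is `C²` at a point agrees near it with a globally `C²` function. -/
theorem exists_contDiff_eventuallyEq {E : Type*} [NormedAddCommGroup E]
    [NormedSpace ℝ E] [HasContDiffBump E] {f : E → ℝ} {x : E} (hf : ContDiffAt ℝ 2 f x) :
    ∃ g : E → ℝ, ContDiff ℝ 2 g ∧ g =ᶠ[𝓝 x] f := by
  obtain ⟨δ, hδ, hball⟩ := Metric.eventually_nhds_iff_ball.1 (hf.eventually (by simp))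
  let χ : ContDiffBump x := ⟨δ / 3, δ / 2, by positivity, by linarith⟩
  refine ⟨fun y => χ y * f y, contDiff_iff_contDiffAt.2 fun y => ?_, ?_⟩
  · by_cases hy : y ∈ Metric.ball x δ
    · exact χ.contDiffAt.mul (hball y hy)
    · have hy' : y ∉ tsupport χ := by
        rw [χ.tsupport_eq, Metric.mem_closedBall]
        rw [Metric.mem_ball] at hy
        change ¬ dist y x ≤ δ / 2
        linarith
      have h0 := notMem_tsupport_iff_eventuallyEq.1 hy'
      refine (contDiffAt_const (c := (0 : ℝ))).congr_of_eventuallyEq ?_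
      filter_upwards [h0] with z hz
      simp [hz]
  · filter_upwards [χ.eventuallyEq_one] with y hy
    simp [hy]

/-- The Hopf-type barrier on the half space `0 < x k`. -/
noncomputable def barrier {n : ℕ} (k : Fin n) (A B b ε C : ℝ) (x : EuclideanSpace ℝ (Fin n)) : ℝ :=
  x k * (A + B * (‖x‖ ^ 2) ^ b) + ε * (‖x‖ ^ 2 - C)

theorem contDiffAt_barrier {n : ℕ} (k : Fin n) (A B b ε C : ℝ) {x : EuclideanSpace ℝ (Fin n)}
    (hx : x ≠ 0) : ContDiffAt ℝ 2 (barrier k A B b ε C) x := by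
  have hk : ContDiffAt ℝ 2 (fun y : EuclideanSpace ℝ (Fin n) => y k) x :=
    (EuclideanSpace.proj (𝕜 := ℝ) k).contDiff.contDiffAt
  have hs : ContDiffAt ℝ 2 (fun y : EuclideanSpace ℝ (Fin n) => ‖y‖ ^ 2) x :=
    (contDiff_norm_sq ℝ).contDiffAt
  unfold barrier
  exact (hk.mul (contDiffAt_const.add (contDiffAt_const.mul
    (hs.rpow_const_of_ne (by positivity))))).add (contDiffAt_const.mul (hs.sub contDiffAt_const))

/-- Second directional derivatives of the barrier. -/
theorem iteratedFDeriv_two_barrier {n : ℕ} {k : Fin n} {A B b ε C : ℝ}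
    {x : EuclideanSpace ℝ (Fin n)} (hx : x ≠ 0) {φ : EuclideanSpace ℝ (Fin n) → ℝ}
    (hφ : ContDiff ℝ 2 φ) (heq : φ =ᶠ[𝓝 x] barrier k A B b ε C) (v : EuclideanSpace ℝ (Fin n)) :
    iteratedFDeriv ℝ 2 φ x ![v, v] =
      B * b * (‖x‖ ^ 2) ^ (b - 1) * (4 * v k * inner ℝ x v + 2 * x k * ‖v‖ ^ 2) +
      4 * B * b * (b - 1) * (‖x‖ ^ 2) ^ (b - 2) * x k * (inner ℝ x v) ^ 2 + 2 * ε * ‖v‖ ^ 2 := by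
  set p := inner ℝ x v with hp
  let s : ℝ → ℝ := fun t => ‖x‖ ^ 2 + 2 * t * p + t ^ 2 * ‖v‖ ^ 2
  let s' : ℝ → ℝ := fun t => 2 * p + 2 * t * ‖v‖ ^ 2
  have hs : ∀ t, HasDerivAt s (s' t) t := fun t => by
    have h1 := ((((hasDerivAt_id t).const_mul 2).mul_const p).const_add (‖x‖ ^ 2)).add
      (((hasDerivAt_id t).pow 2).mul_const (‖v‖ ^ 2))
    refine h1.congr_deriv ?_
    simp [s']
  have hs' : ∀ t, HasDerivAt s' (2 * ‖v‖ ^ 2) t := fun t => by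
    have h1 := (((hasDerivAt_id t).const_mul 2).mul_const (‖v‖ ^ 2)).const_add (2 * p)
    refine h1.congr_deriv ?_
    simp
  have hs0 : s 0 = ‖x‖ ^ 2 := by simp [s]
  have hs'0 : s' 0 = 2 * p := by simp [s']
  have hl : ∀ t, HasDerivAt (fun t => x k + t * v k) (v k) t := fun t => by
    simpa using ((hasDerivAt_id t).mul_const (v k)).const_add (x k)
  have hxpos : 0 < ‖x‖ ^ 2 := by positivity
  have hpos : ∀ᶠ t in 𝓝 (0 : ℝ), s t ≠ 0 :=
    (hs 0).continuousAt.eventually_ne (by rw [hs0]; exact hxpos.ne')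
  have hlim : Filter.Tendsto (fun t : ℝ => x + t • v) (𝓝 0) (𝓝 x) := by
    have : Continuous fun t : ℝ => x + t • v := by fun_prop
    simpa using this.tendsto 0
  refine iteratedFDeriv_two_eq_of_line hφ x v
    (h := fun t => (x k + t * v k) * (A + B * s t ^ b) + ε * (s t - C))
    (h' := fun t => v k * (A + B * s t ^ b) +
      (x k + t * v k) * (B * (s' t * b * s t ^ (b - 1))) + ε * s' t) ?_ ?_ ?_
  · filter_upwards [hlim.eventually heq] with t ht
    have hn : ‖x + t • v‖ ^ 2 = s t := by
      rw [norm_add_sq_real, real_inner_smul_right, norm_smul, mul_pow, Real.norm_eq_abs, sq_abs]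
      simp only [s, hp]
      ring
    rw [ht, barrier, hn]
    simp
  · filter_upwards [hpos] with t ht
    exact ((hl t).mul ((((hs t).rpow_const (Or.inl ht)).const_mul B).const_add A)).add
      (((hs t).sub_const C).const_mul ε)
  · have hne : s 0 ≠ 0 := by rw [hs0]; exact hxpos.ne'
    have h1 := (((((hs 0).rpow_const (p := b) (Or.inl hne)).const_mul B).const_add A).const_mul
      (v k)).add ((hl 0).mul ((((hs' 0).mul_const b).mul
        ((hs 0).rpow_const (p := b - 1) (Or.inl hne))).const_mul B))
    refine (h1.add ((hs' 0).const_mul ε)).congr_deriv ?_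
    simp only [Pi.mul_apply]
    rw [hs0, hs'0, show b - 1 - 1 = b - 2 by ring]
    ring

/-- The barrier is a strict subsolution in the half space. -/
theorem pucciMax_hess_barrier_pos {n : ℕ} {k : Fin n} {lam Lam A B b ε C : ℝ} (hlam : 0 < lam)
    (hLam : lam ≤ Lam) (hb : Lam * (4 * b + 2) + lam * (2 * n - 2) = 0) (hε : 0 < ε)
    {x : EuclideanSpace ℝ (Fin n)} (hx : x ≠ 0) {φ : EuclideanSpace ℝ (Fin n) → ℝ}
    (hφ : ContDiff ℝ 2 φ) (heq : φ =ᶠ[𝓝 x] barrier k A B b ε C) :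
    0 < pucciMax lam Lam (hess φ x) := by
  have hxpos : 0 < ‖x‖ := norm_pos_iff.2 hx
  have hvn : ‖‖x‖⁻¹ • x‖ = 1 := by
    rw [norm_smul, norm_inv, norm_norm, inv_mul_cancel₀ hxpos.ne']
  have hpow : (‖x‖ ^ 2) ^ (b - 1) = (‖x‖ ^ 2) ^ (b - 2) * ‖x‖ ^ 2 := by
    rw [← Real.rpow_add_one (by positivity)]
    congr 1
    ring
  have htrace : (hess φ x).trace =
      B * b * (‖x‖ ^ 2) ^ (b - 1) * x k * (4 * b + 2 * n) + 2 * ε * n := by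
    have hterm : ∀ i, hess φ x i i =
        B * b * (‖x‖ ^ 2) ^ (b - 1) * (4 * (if k = i then x i else 0) + 2 * x k) +
        4 * B * b * (b - 1) * (‖x‖ ^ 2) ^ (b - 2) * x k * (x i) ^ 2 + 2 * ε := fun i => by
      rw [hess, iteratedFDeriv_two_barrier hx hφ heq]
      by_cases hki : k = i <;> simp [hki, EuclideanSpace.inner_single_right]
    simp only [Matrix.trace, Matrix.diag_apply, hterm]
    rw [Finset.sum_add_distrib, Finset.sum_add_distrib, ← Finset.mul_sum, ← Finset.mul_sum,
      ← EuclideanSpace.real_norm_sq_eq, Finset.sum_add_distrib, ← Finset.mul_sum,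
      Finset.sum_ite_eq]
    simp only [Finset.mem_univ, if_true, Finset.sum_const, Finset.card_univ, Fintype.card_fin,
      nsmul_eq_mul, hpow]
    ring
  have hquad := iteratedFDeriv_two_barrier hx hφ heq (‖x‖⁻¹ • x)
  rw [hvn, real_inner_smul_right, real_inner_self_eq_norm_sq, PiLp.smul_apply, smul_eq_mul,
    hpow] at hquad
  have hle := le_pucciMax hLam (isHermitian_hess hφ x) hvn.le
  rw [dotProduct_hess_mulVec, hquad, htrace, hpow] at hle
  have hn : (1 : ℝ) ≤ n := by exact_mod_cast Fin.pos k
  have key : lam * (B * b * ((‖x‖ ^ 2) ^ (b - 2) * ‖x‖ ^ 2) * x k * (4 * b + 2 * n) + 2 * ε * n) +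
      (Lam - lam) * (B * b * ((‖x‖ ^ 2) ^ (b - 2) * ‖x‖ ^ 2) *
        (4 * (‖x‖⁻¹ * x k) * (‖x‖⁻¹ * ‖x‖ ^ 2) + 2 * x k * 1 ^ 2) +
        4 * B * b * (b - 1) * (‖x‖ ^ 2) ^ (b - 2) * x k * (‖x‖⁻¹ * ‖x‖ ^ 2) ^ 2 +
        2 * ε * 1 ^ 2) = 2 * ε * (lam * n + (Lam - lam)) := by
    have h1 : ‖x‖⁻¹ * ‖x‖ ^ 2 = ‖x‖ := by field_simp
    have h2 : 4 * (‖x‖⁻¹ * x k) * ‖x‖ = 4 * x k := by field_simp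
    rw [h1, h2]
    linear_combination B * b * (‖x‖ ^ 2) ^ (b - 2) * ‖x‖ ^ 2 * x k * hb
  rw [key] at hle
  refine lt_of_lt_of_le ?_ hle
  have : 0 < lam * n := by positivity
  have : 0 < lam * n + (Lam - lam) := by linarith
  positivity

/-- Comparison of a supersolution with the barrier on a half annulus. -/
theorem barrier_le_of_pucciSupersol {n : ℕ} {k : Fin n} {lam Lam A B b r R : ℝ} (hlam : 0 < lam)
    (hLam : lam ≤ Lam) (hb : Lam * (4 * b + 2) + lam * (2 * n - 2) = 0) (hr : 0 < r)
    {u : EuclideanSpace ℝ (Fin n) → ℝ} (hu : LowerSemicontinuousOn u {x | 0 ≤ x k})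
    (hnonneg : ∀ x : EuclideanSpace ℝ (Fin n), 0 ≤ x k → 0 ≤ u x)
    (hsuper : PucciSupersol lam Lam {x | 0 < x k} u (fun _ => 0))
    (hur : ∀ x : EuclideanSpace ℝ (Fin n), 0 < x k → (‖x‖ = r ∨ ‖x‖ = R) →
      x k * (A + B * (‖x‖ ^ 2) ^ b) ≤ u x)
    {y : EuclideanSpace ℝ (Fin n)} (hyk : 0 < y k) (hry : r ≤ ‖y‖) (hyR : ‖y‖ ≤ R) :
    y k * (A + B * (‖y‖ ^ 2) ^ b) ≤ u y := by
  have hstrict : ∀ ε > 0, barrier k A B b ε (R ^ 2) y ≤ u y := by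
    intro ε hε
    by_contra! hlt
    let K : Set (EuclideanSpace ℝ (Fin n)) := {x | 0 ≤ x k ∧ r ≤ ‖x‖ ∧ ‖x‖ ≤ R}
    have hck : Continuous fun x : EuclideanSpace ℝ (Fin n) => x k :=
      (EuclideanSpace.proj (𝕜 := ℝ) k).continuous
    have hK : IsCompact K := by
      refine (isCompact_closedBall (0 : EuclideanSpace ℝ (Fin n)) R).of_isClosed_subset ?_
        fun x hx => by simpa using hx.2.2
      exact (isClosed_le continuous_const hck).inter
        ((isClosed_le continuous_const continuous_norm).inter
          (isClosed_le continuous_norm continuous_const))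
    have hne : ∀ x ∈ K, x ≠ 0 := fun x hx => norm_pos_iff.1 (hr.trans_le hx.2.1)
    have hcont : ContinuousOn (barrier k A B b ε (R ^ 2)) K := fun x hx =>
      (contDiffAt_barrier k A B b ε (R ^ 2) (hne x hx)).continuousAt.continuousWithinAt
    have hlsc : LowerSemicontinuousOn (fun x => u x + -barrier k A B b ε (R ^ 2) x) K :=
      (hu.mono fun x hx => hx.1).add hcont.neg.lowerSemicontinuousOn
    have hyK : y ∈ K := ⟨hyk.le, hry, hyR⟩
    obtain ⟨x, hx, hmin⟩ := LowerSemicontinuousOn.exists_isMinOn ⟨y, hyK⟩ hK hlsc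
    have hneg : u x < barrier k A B b ε (R ^ 2) x := by
      have := isMinOn_iff.1 hmin y hyK
      linarith
    have hx2 : ε * (‖x‖ ^ 2 - R ^ 2) ≤ 0 := by
      refine mul_nonpos_of_nonneg_of_nonpos hε.le (sub_nonpos.2 ?_)
      gcongr
      exact hx.2.2
    have hlt' : u x < x k * (A + B * (‖x‖ ^ 2) ^ b) := by
      unfold barrier at hneg
      linarith
    have hxk : 0 < x k := by
      refine hx.1.lt_of_ne fun h0 => ?_
      rw [← h0, zero_mul] at hlt'
      exact hlt'.not_ge (hnonneg x hx.1)
    have hxr : r < ‖x‖ := hx.2.1.lt_of_ne fun h =>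
      hlt'.not_ge (hur x hxk (Or.inl h.symm))
    have hxR : ‖x‖ < R := hx.2.2.lt_of_ne fun h => hlt'.not_ge (hur x hxk (Or.inr h))
    have hKn : K ∈ 𝓝 x := by
      filter_upwards [hck.continuousAt.eventually (lt_mem_nhds hxk),
        continuous_norm.continuousAt.eventually (lt_mem_nhds hxr),
        continuous_norm.continuousAt.eventually (gt_mem_nhds hxR)] with z h1 h2 h3
      exact ⟨h1.le, h2.le, h3.le⟩
    obtain ⟨φ, hφ, heq⟩ :=
      exists_contDiff_eventuallyEq (contDiffAt_barrier k A B b ε (R ^ 2) (hne x hx))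
    have hloc : IsLocalMin (fun z => u z - φ z) x := by
      filter_upwards [hKn, heq] with z hz hzφ
      have := isMinOn_iff.1 hmin z hz
      rw [hzφ, heq.self_of_nhds]
      linarith
    have hle := hsuper x hxk φ hφ hloc
    have hpos := pucciMax_hess_barrier_pos hlam hLam hb hε (hne x hx) hφ heq
    linarith
  refine le_of_forall_pos_le_add fun δ hδ => ?_
  have hD : 0 < 1 + R ^ 2 := by positivity
  have h1 := hstrict (δ / (1 + R ^ 2)) (by positivity)
  unfold barrier at h1
  have h2 : δ / (1 + R ^ 2) * (‖y‖ ^ 2 - R ^ 2) ≥ -δ := by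
    have h3 : δ / (1 + R ^ 2) * (1 + R ^ 2) = δ := by field_simp
    have h4 : 0 ≤ δ / (1 + R ^ 2) * (1 + ‖y‖ ^ 2) := by positivity
    linarith
  linarith

theorem stmt16 (n : ℕ) (hn : 2 ≤ n) (lam Lam : ℝ) (hlam : 0 < lam) (hLam : lam ≤ Lam)
    (nt : ℝ) (hnt : nt = lam / Lam * ((n : ℝ) - 1) + 1)
    (u : EuclideanSpace ℝ (Fin n) → ℝ)
    (hu : LowerSemicontinuousOn u {x | 0 ≤ x ⟨n - 1, by omega⟩})
    (hnonneg : ∀ x : EuclideanSpace ℝ (Fin n), 0 ≤ x ⟨n - 1, by omega⟩ → 0 ≤ u x)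
    (hsuper : PucciSupersol lam Lam {x | 0 < x ⟨n - 1, by omega⟩} u (fun _ => 0))
    (m : ℝ → ℝ)
    (hm : ∀ r : ℝ, m r = sInf ((fun x : EuclideanSpace ℝ (Fin n) => u x / x ⟨n - 1, by omega⟩) ''
      {x : EuclideanSpace ℝ (Fin n) | 0 < x ⟨n - 1, by omega⟩ ∧ ‖x‖ < r})) :
    ∀ r R ρ : ℝ, 0 < r → r < R → r ≤ ρ → ρ ≤ R →
      (m r * (ρ ^ (-nt) - R ^ (-nt)) + m R * (r ^ (-nt) - ρ ^ (-nt))) /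
        (r ^ (-nt) - R ^ (-nt)) ≤ m ρ := by
  intro r R ρ hr hrR hrρ hρR
  set k : Fin n := ⟨n - 1, by omega⟩
  have hLpos : 0 < Lam := hlam.trans_le hLam
  have hn1 : (1 : ℝ) ≤ n := by exact_mod_cast (by omega : 1 ≤ n)
  have hntpos : 0 < nt := by
    have : 0 ≤ lam / Lam * ((n : ℝ) - 1) := mul_nonneg (by positivity) (by linarith)
    linarith
  have hanti : ∀ {s t : ℝ}, 0 < s → s ≤ t → t ^ (-nt) ≤ s ^ (-nt) := fun hs hst =>
    Real.rpow_le_rpow_of_nonpos hs hst (by linarith)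
  have hden : 0 < r ^ (-nt) - R ^ (-nt) :=
    sub_pos.2 (Real.rpow_lt_rpow_of_neg hr hrR (by linarith))
  have hρ : 0 < ρ := hr.trans_le hrρ
  have hne : ∀ s > 0, ((fun x : EuclideanSpace ℝ (Fin n) => u x / x k) ''
      {x : EuclideanSpace ℝ (Fin n) | 0 < x k ∧ ‖x‖ < s}).Nonempty := fun s hs => by
    refine ⟨_, EuclideanSpace.single k (s / 2), ⟨?_, ?_⟩, rfl⟩
    · simpa using hs
    · rw [PiLp.norm_single, Real.norm_eq_abs, abs_of_pos (by positivity)]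
      linarith
  have hbdd : ∀ s, BddBelow ((fun x : EuclideanSpace ℝ (Fin n) => u x / x k) ''
      {x : EuclideanSpace ℝ (Fin n) | 0 < x k ∧ ‖x‖ < s}) := fun s => by
    refine ⟨0, ?_⟩
    rintro _ ⟨x, ⟨hx, -⟩, rfl⟩
    exact div_nonneg (hnonneg x hx.le) hx.le
  have hmle : ∀ s (x : EuclideanSpace ℝ (Fin n)), 0 < x k → ‖x‖ < s → m s ≤ u x / x k :=
    fun s x hx hxs => (hm s).trans_le (csInf_le (hbdd s) ⟨x, ⟨hx, hxs⟩, rfl⟩)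
  have hlem : ∀ s > 0, ∀ c, (∀ x : EuclideanSpace ℝ (Fin n), 0 < x k → ‖x‖ < s → c ≤ u x / x k) →
      c ≤ m s := fun s hs c hc => by
    rw [hm]
    refine le_csInf (hne s hs) ?_
    rintro _ ⟨x, ⟨hx, hxs⟩, rfl⟩
    exact hc x hx hxs
  have hmono : m R ≤ m r := hlem r hr _ fun x hx hxr => hmle R x hx (hxr.trans hrR)
  set B := (m r - m R) / (r ^ (-nt) - R ^ (-nt)) with hB
  set A := m R - B * R ^ (-nt) with hA
  have hB0 : 0 ≤ B := div_nonneg (sub_nonneg.2 hmono) hden.le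
  have hBmul : B * (r ^ (-nt) - R ^ (-nt)) = m r - m R := div_mul_cancel₀ _ hden.ne'
  have hAr : A + B * r ^ (-nt) = m r := by rw [hA]; linear_combination hBmul
  have hAR : A + B * R ^ (-nt) = m R := by rw [hA]; ring
  have hgoal : (m r * (ρ ^ (-nt) - R ^ (-nt)) + m R * (r ^ (-nt) - ρ ^ (-nt))) /
      (r ^ (-nt) - R ^ (-nt)) = A + B * ρ ^ (-nt) := by
    rw [div_eq_iff hden.ne']
    linear_combination (-(ρ ^ (-nt) - R ^ (-nt))) * hAr - (r ^ (-nt) - ρ ^ (-nt)) * hAR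
  rw [hgoal]
  rcases hρR.eq_or_lt with rfl | hρR'
  · exact hAR.le
  refine le_of_forall_pos_le_add fun δ hδ => ?_
  have hclose : ∀ s > 0, ∀ t < s, ∃ s', t < s' ∧ s' < s ∧ 0 < s' ∧
      B * s' ^ (-nt) < B * s ^ (-nt) + δ := fun s hs t ht => by
    have hc : ContinuousAt (fun z : ℝ => B * z ^ (-nt)) s :=
      continuousAt_const.mul (Real.continuousAt_rpow_const _ _ (Or.inl hs.ne'))
    have h1 := (hc.eventually (gt_mem_nhds (show B * s ^ (-nt) < B * s ^ (-nt) + δ by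
      linarith))).filter_mono (nhdsWithin_le_nhds (s := Set.Iio s))
    have h2 : ∀ᶠ z in 𝓝[<] s, z ∈ Set.Ioo (max t 0) s := Ioo_mem_nhdsLT (max_lt ht hs)
    obtain ⟨z, hz1, hz2⟩ := (h1.and h2).exists
    exact ⟨z, (le_max_left _ _).trans_lt hz2.1, hz2.2, (le_max_right _ _).trans_lt hz2.1, hz1⟩
  obtain ⟨r', -, hr'r, hr'0, hr'δ⟩ := hclose r hr 0 hr
  obtain ⟨R', hρR'', hR'R, -, hR'δ⟩ := hclose R (hr.trans hrR) ρ hρR'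
  have hb : Lam * (4 * (-nt / 2) + 2) + lam * (2 * n - 2) = 0 := by
    rw [hnt]
    field_simp
    ring
  have hpow : ∀ x : EuclideanSpace ℝ (Fin n), (‖x‖ ^ 2) ^ (-nt / 2) = ‖x‖ ^ (-nt) := fun x => by
    rw [← Real.rpow_natCast_mul (norm_nonneg x)]
    congr 1
    push_cast
    ring
  rw [← sub_le_iff_le_add]
  refine hlem ρ hρ _ fun x hx hxρ => ?_
  rcases le_or_gt ‖x‖ r' with hxr | hxr
  · have h1 := hmle r x hx (hxr.trans_lt hr'r)
    have h2 : B * ρ ^ (-nt) ≤ B * r ^ (-nt) := mul_le_mul_of_nonneg_left (hanti hr hrρ) hB0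
    linarith
  · have hbd : ∀ z : EuclideanSpace ℝ (Fin n), 0 < z k → (‖z‖ = r' ∨ ‖z‖ = R') →
        z k * ((A - δ) + B * (‖z‖ ^ 2) ^ (-nt / 2)) ≤ u z := by
      intro z hz hzn
      rw [hpow, mul_comm, ← le_div_iff₀ hz]
      rcases hzn with hzn | hzn
      · have h1 := hmle r z hz (hzn.trans_lt hr'r)
        rw [hzn]
        linarith
      · have h1 := hmle R z hz (hzn.trans_lt hR'R)
        rw [hzn]
        linarith
    have h1 := barrier_le_of_pucciSupersol hlam hLam hb hr'0 hu hnonneg hsuper hbd hx hxr.le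
      (hxρ.trans hρR'').le
    rw [hpow, mul_comm, ← le_div_iff₀ hx] at h1
    have h2 : B * ρ ^ (-nt) ≤ B * ‖x‖ ^ (-nt) :=
      mul_le_mul_of_nonneg_left (hanti (hr'0.trans hxr) hxρ.le) hB0
    linarith
end
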